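/- Let n ≥ 2, let B be a skew-symmetrizable n×n integer matrix of type C_n, and let D be a diagonal matrix with positive integer diagonal entries such that DB is skew-symmetric. For every seed of the cluster pattern with principal coefficients and initial matrix B, let G be its G-matrix (the n×n matrix whose j-th column is the g-vector of its j-th cluster variable) and let C be its C-matrix (the bottom n×n part of its 2n×n exchange matrix). Then Gᵀ·D·C = D. -/

import Mathlib

open MvPolynomial Matrix

noncomputable section

/-- Fomin–Zelevinsky matrix mutation in direction `k`. -/
def mutMat {n : ℕ} (k : Fin n) (B : Matrix (Fin n) (Fin n) ℤ) :
    Matrix (Fin n) (Fin n) ℤ := fun i j =>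
  if i = k ∨ j = k then -B i j
  else B i j + (B i k).sign * max (B i k * B k j) 0

/-- `B` is skew-symmetrizable: `D * B` is skew-symmetric for some diagonal `D`
with positive integer diagonal entries. -/
def SkewSymmetrizable {n : ℕ} (B : Matrix (Fin n) (Fin n) ℤ) : Prop :=
  ∃ d : Fin n → ℤ, (∀ i, 0 < d i) ∧
    (Matrix.diagonal d * B)ᵀ = -(Matrix.diagonal d * B)

/-- The Cartan counterpart `A(B)` of `B`. -/
def cartanCounterpart {n : ℕ} (B : Matrix (Fin n) (Fin n) ℤ) :
    Matrix (Fin n) (Fin n) ℤ := fun i j => if i = j then 2 else -|B i j|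

/-- The Cartan matrix of type `C_n` (with rows and columns indexed by
`0, …, n-1`): `2` on the diagonal, `-2` in position `(n-2, n-1)`, and `-1`
in the remaining positions `(i, i±1)`. -/
def cartanC (n : ℕ) : Matrix (Fin n) (Fin n) ℤ := fun i j =>
  if i = j then 2
  else if i.val + 2 = n ∧ j.val + 1 = n then -2
  else if i.val + 1 = j.val ∨ j.val + 1 = i.val then -1 else 0

/-- The matrix `B` is of type `C_n`: some matrix obtained from `B` by a finite
sequence of mutations has Cartan counterpart equal, up to simultaneous
permutation of rows and columns, to the Cartan matrix of type `C_n`. -/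
def MatrixOfTypeC {n : ℕ} (B : Matrix (Fin n) (Fin n) ℤ) : Prop :=
  ∃ B', Relation.ReflTransGen (fun a c => ∃ k, c = mutMat k a) B B' ∧
    ∃ σ : Equiv.Perm (Fin n),
      ∀ i j, cartanCounterpart B' (σ i) (σ j) = cartanC n i j

/-- Mutation in direction `k` of a `2n × n` integer matrix (rows indexed by
`Fin n ⊕ Fin n`, the first block being the principal part). -/
def mutMatExt {n : ℕ} (k : Fin n) (b : Matrix (Fin n ⊕ Fin n) (Fin n) ℤ) :
    Matrix (Fin n ⊕ Fin n) (Fin n) ℤ := fun i j =>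
  if i = Sum.inl k ∨ j = k then -b i j
  else b i j + (b i k).sign * max (b i k * b (Sum.inl k) j) 0

/-- The `2n × n` matrix `B̃` with top part `B` and bottom part the identity. -/
def extMat {n : ℕ} (B : Matrix (Fin n) (Fin n) ℤ) :
    Matrix (Fin n ⊕ Fin n) (Fin n) ℤ := fun i j =>
  Sum.elim (fun i' => B i' j) (fun i' => if i' = j then 1 else 0) i

/-- The `2n × n` exchange matrices of the principal-coefficients pattern with
initial matrix `B`: all matrices obtained from `B̃` by finite sequences of
mutations. -/
def IsExtMat {n : ℕ} (B : Matrix (Fin n) (Fin n) ℤ)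
    (b : Matrix (Fin n ⊕ Fin n) (Fin n) ℤ) : Prop :=
  Relation.ReflTransGen (fun a c => ∃ k, c = mutMatExt k a) (extMat B) b

/-- `c` is a `c`-vector of the cluster algebra with principal coefficients and
initial exchange matrix `B`: a column of the bottom part of some exchange
matrix of the pattern. -/
def IsCVec {n : ℕ} (B : Matrix (Fin n) (Fin n) ℤ) (c : Fin n → ℤ) : Prop :=
  ∃ b, IsExtMat B b ∧ ∃ j, c = fun i => b (Sum.inr i) j

/-- The ambient field `ℚ(x_1, …, x_{2n})` for principal coefficients. -/
abbrev PField (n : ℕ) : Type := FractionRing (MvPolynomial (Fin n ⊕ Fin n) ℚ)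

/-- The generators `x_1, …, x_{2n}` of `PField n`. -/
def xVar (n : ℕ) (i : Fin n ⊕ Fin n) : PField n :=
  algebraMap (MvPolynomial (Fin n ⊕ Fin n) ℚ) (PField n) (X i)

/-- Seed mutation in direction `k` for the principal-coefficients pattern. -/
def mutSeedP {n : ℕ} (k : Fin n)
    (s : Matrix (Fin n ⊕ Fin n) (Fin n) ℤ × (Fin n → PField n)) :
    Matrix (Fin n ⊕ Fin n) (Fin n) ℤ × (Fin n → PField n) :=
  (mutMatExt k s.1,
    Function.update s.2 k
      (((∏ i, s.2 i ^ (s.1 (Sum.inl i) k).toNat) *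
            ∏ j, xVar n (Sum.inr j) ^ (s.1 (Sum.inr j) k).toNat +
          (∏ i, s.2 i ^ (-(s.1 (Sum.inl i) k)).toNat) *
            ∏ j, xVar n (Sum.inr j) ^ (-(s.1 (Sum.inr j) k)).toNat) / s.2 k))

/-- The initial seed of the principal-coefficients pattern. -/
def initSeedP (n : ℕ) (B : Matrix (Fin n) (Fin n) ℤ) :
    Matrix (Fin n ⊕ Fin n) (Fin n) ℤ × (Fin n → PField n) :=
  (extMat B, fun i => xVar n (Sum.inl i))

/-- The seeds of the principal-coefficients pattern with initial matrix `B`. -/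
def IsSeedP {n : ℕ} (B : Matrix (Fin n) (Fin n) ℤ)
    (s : Matrix (Fin n ⊕ Fin n) (Fin n) ℤ × (Fin n → PField n)) : Prop :=
  Relation.ReflTransGen (fun a b => ∃ k, b = mutSeedP k a) (initSeedP n B) s

/-- The `ℤⁿ`-degree of the monomial with exponent vector `m`, where
`deg x_i = e_i` and `deg x_{n+j} = -(B_{1j}, …, B_{nj})`. -/
def wtOf {n : ℕ} (B : Matrix (Fin n) (Fin n) ℤ)
    (m : (Fin n ⊕ Fin n) →₀ ℕ) : Fin n → ℤ := fun i =>
  (m (Sum.inl i) : ℤ) - ∑ j, (m (Sum.inr j) : ℤ) * B i j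

/-- A polynomial is homogeneous of degree `g` for the principal-coefficients
`ℤⁿ`-grading determined by `B`. -/
def IsHomogOfWt {n : ℕ} (B : Matrix (Fin n) (Fin n) ℤ) (g : Fin n → ℤ)
    (p : MvPolynomial (Fin n ⊕ Fin n) ℚ) : Prop :=
  ∀ m ∈ p.support, wtOf B m = g

/-- `y` is homogeneous of degree `g` for the `ℤⁿ`-grading determined by `B`;
for a cluster variable `y`, the vector `g` is its `g`-vector. -/
def HasGVector {n : ℕ} (B : Matrix (Fin n) (Fin n) ℤ) (g : Fin n → ℤ)
    (y : PField n) : Prop :=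
  ∃ p q : MvPolynomial (Fin n ⊕ Fin n) ℚ, ∃ gp gq : Fin n → ℤ,
    IsHomogOfWt B gp p ∧ IsHomogOfWt B gq q ∧ q ≠ 0 ∧
      y = algebraMap (MvPolynomial (Fin n ⊕ Fin n) ℚ) (PField n) p /
            algebraMap (MvPolynomial (Fin n ⊕ Fin n) ℚ) (PField n) q ∧
      g = gp - gq


section TriSec

def EdgeT {ι : Type} (h : ℤ) (A : ι → ℤ → ℤ → Prop) (p q : ℤ) : Prop :=
  q = p + 1 ∨ q = p + 2 * h - 1 ∨ ∃ i, A i p q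

/-- A centrally symmetric triangulation of a `2h`-gon, lifted to `ℤ`. -/
structure TriC {ι : Type} (h : ℤ) (A : ι → ℤ → ℤ → Prop) : Prop where
  ne : ∀ i, ∃ p q, A i p q
  lo : ∀ {i p q}, A i p q → p + 2 ≤ q
  hi : ∀ {i p q}, A i p q → q + 2 ≤ p + 2 * h
  rot : ∀ {i p q}, A i p q → A i q (p + 2 * h)
  shift : ∀ {i p q} (t : ℤ), A i p q → A i (p + t * h) (q + t * h)
  orb : ∀ {i p q r s}, A i p q → A i r s →
    ∃ t : ℤ, (r = p + t * h ∧ s = q + t * h) ∨ (r = q + t * h ∧ s = p + 2 * h + t * h)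
  disj : ∀ {i j p q}, A i p q → A j p q → i = j
  nc : ∀ {i j a b c d}, A i a c → A j b d → a < b → b < c → c < d → d < a + 2 * h → False
  third : ∀ {i p q}, A i p q → ∃ m, p < m ∧ m < q ∧ EdgeT h A p m ∧ EdgeT h A m q

def QuadT {ι : Type} (h : ℤ) (A : ι → ℤ → ℤ → Prop) (k : ι) (p m q m' : ℤ) : Prop :=
  A k p q ∧ p < m ∧ m < q ∧ q < m' ∧ m' < p + 2 * h ∧
    EdgeT h A p m ∧ EdgeT h A m q ∧ EdgeT h A q m' ∧ EdgeT h A m' (p + 2 * h)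

open Classical in
def flipT {ι : Type} (h : ℤ) (A : ι → ℤ → ℤ → Prop) (k : ι) (i : ι) (p q : ℤ) : Prop :=
  if i = k then ∃ r s, QuadT h A k r p s q else A i p q

variable {ι : Type} {h : ℤ} {A : ι → ℤ → ℤ → Prop}

theorem mulcases (t h : ℤ) (hh : 0 < h) : t * h = 0 ∨ t * h = h ∨ t * h = -h ∨ t * h = 2 * h ∨
    t * h = -(2 * h) ∨ 3 * h ≤ t * h ∨ t * h ≤ -(3 * h) := by
  by_cases h1 : 3 ≤ t
  · have : 3 * h ≤ t * h := by nlinarith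
    omega
  by_cases h2 : t ≤ -3
  · have : t * h ≤ -(3 * h) := by nlinarith
    omega
  have : t = -2 ∨ t = -1 ∨ t = 0 ∨ t = 1 ∨ t = 2 := by omega
  rcases this with rfl | rfl | rfl | rfl | rfl <;> omega

theorem TriC.shift2 (T : TriC h A) {i p q} (H : A i p q) : A i (p + 2 * h) (q + 2 * h) := T.shift 2 H

theorem TriC.rot' (T : TriC h A) {i p q} (H : A i q (p + 2 * h)) : A i p q := by
  have := T.shift (-2) (T.rot H)
  convert this using 1 <;> ring

theorem TriC.shift2' (T : TriC h A) {i p q} (H : A i (p + 2 * h) (q + 2 * h)) : A i p q :=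
  T.rot' (T.rot' H)

theorem TriC.edge_rot (T : TriC h A) {p q} (H : EdgeT h A p q) : EdgeT h A q (p + 2 * h) := by
  rcases H with H | H | ⟨i, H⟩
  · right; left; omega
  · left; omega
  · exact Or.inr (Or.inr ⟨i, T.rot H⟩)

theorem TriC.edge_shift (T : TriC h A) (t : ℤ) {p q} (H : EdgeT h A p q) :
    EdgeT h A (p + t * h) (q + t * h) := by
  rcases H with H | H | ⟨i, H⟩
  · left; omega
  · right; left; omega
  · exact Or.inr (Or.inr ⟨i, T.shift t H⟩)

theorem TriC.edge_shift2 (T : TriC h A) {p q} (H : EdgeT h A p q) :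
    EdgeT h A (p + 2 * h) (q + 2 * h) := T.edge_shift 2 H

theorem TriC.edge_nc (T : TriC h A) {a b c d} (H : EdgeT h A a c) (H' : EdgeT h A b d)
    (h1 : a < b) (h2 : b < c) (h3 : c < d) (h4 : d < a + 2 * h) : False := by
  rcases H with H | H | ⟨i, H⟩
  · omega
  · omega
  rcases H' with H' | H' | ⟨j, H'⟩
  · omega
  · omega
  exact T.nc H H' h1 h2 h3 h4

theorem TriC.uniq (T : TriC h A) {p m n q} (hq : q < p + 2 * h)
    (h1 : EdgeT h A p m) (h2 : EdgeT h A m q) (h3 : EdgeT h A p n) (h4 : EdgeT h A n q)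
    (hm : p < m) (hm' : m < q) (hn : p < n) (hn' : n < q) : m = n := by
  rcases lt_trichotomy m n with H | H | H
  · exact (T.edge_nc h3 h2 hm H hn' hq).elim
  · exact H
  · exact (T.edge_nc h1 h4 hn H hm' hq).elim

theorem TriC.adj (T : TriC h A) {k a b c} (h1 : A k a b) (h2 : A k b c) (hc : c < a + 2 * h) :
    False := by
  obtain ⟨t, H⟩ := T.orb h1 h2
  have := T.lo h1
  have := T.hi h1
  have := T.lo h2
  have := mulcases t h (by omega)
  omega

theorem TriC.adj' (T : TriC h A) {k a b c} (h1 : A k a b) (h2 : A k a c) (hc : b < c) :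
    False := by
  have := T.hi h2
  exact T.adj (T.rot h2) (T.shift2 h1) (by omega)

theorem TriC.adj'' (T : TriC h A) {k a b c} (h1 : A k a c) (h2 : A k b c) (hc : a < b) :
    False := by
  have := T.lo h1
  have := T.hi h2
  have := T.lo h2
  exact T.adj h2 (T.rot h1) (by omega)

theorem QuadT.rot (T : TriC h A) {k p m q m'} (H : QuadT h A k p m q m') :
    QuadT h A k q m' (p + 2 * h) (m + 2 * h) := by
  obtain ⟨h0, h1, h2, h3, h4, e1, e2, e3, e4⟩ := H
  exact ⟨T.rot h0, h3, h4, by omega, by omega, e3, e4, T.edge_shift2 e1, T.edge_shift2 e2⟩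

theorem QuadT.shift (T : TriC h A) (t : ℤ) {k p m q m'} (H : QuadT h A k p m q m') :
    QuadT h A k (p + t * h) (m + t * h) (q + t * h) (m' + t * h) := by
  obtain ⟨h0, h1, h2, h3, h4, e1, e2, e3, e4⟩ := H
  refine ⟨T.shift t h0, by omega, by omega, by omega, by omega, T.edge_shift t e1,
    T.edge_shift t e2, T.edge_shift t e3, ?_⟩
  have := T.edge_shift t e4
  convert this using 1; ring

theorem TriC.quad (T : TriC h A) {k p q} (H : A k p q) : ∃ m m', QuadT h A k p m q m' := by
  obtain ⟨m, h1, h2, e1, e2⟩ := T.third H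
  obtain ⟨m', h1', h2', e1', e2'⟩ := T.third (T.rot H)
  exact ⟨m, m', H, h1, h2, h1', h2', e1, e2, e1', e2'⟩

theorem TriC.quad_uniq (T : TriC h A) {k p m q m' n n'} (H : QuadT h A k p m q m')
    (H' : QuadT h A k p n q n') : m = n ∧ m' = n' := by
  obtain ⟨h0, h1, h2, h3, h4, e1, e2, e3, e4⟩ := H
  obtain ⟨h0', h1', h2', h3', h4', e1', e2', e3', e4'⟩ := H'
  exact ⟨T.uniq (by omega) e1 e2 e1' e2' h1 h2 h1' h2',
    T.uniq (by omega) e3 e4 e3' e4' h3 h4 h3' h4'⟩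

/-- Sides of the quadrilateral of `k` are not in the class of `k`. -/
theorem TriC.side (T : TriC h A) {k p m q m'} (H : QuadT h A k p m q m') :
    ¬ A k p m ∧ ¬ A k m q ∧ ¬ A k q m' ∧ ¬ A k m' (p + 2 * h) := by
  obtain ⟨h0, h1, h2, h3, h4, e1, e2, e3, e4⟩ := H
  exact ⟨fun H => T.adj' H h0 h2, fun H => T.adj'' h0 H h1, fun H => T.adj' H (T.rot h0) h4,
    fun H => T.adj'' (T.rot h0) H h3⟩

/-- No cancellation. -/
theorem TriC.nocancel (T : TriC h A) {j k p m q m'} (H : QuadT h A j p m q m') :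
    ¬ (A k p m ∧ A k m q) ∧ ¬ (A k m q ∧ A k q m') ∧ ¬ (A k q m' ∧ A k m' (p + 2 * h)) ∧
      ¬ (A k m' (p + 2 * h) ∧ A k p m) := by
  obtain ⟨h0, h1, h2, h3, h4, e1, e2, e3, e4⟩ := H
  exact ⟨fun H => T.adj H.1 H.2 (by omega), fun H => T.adj H.1 H.2 (by omega),
    fun H => T.adj H.1 H.2 (by omega), fun H => T.adj H.1 (T.shift2 H.2) (by omega)⟩

theorem flipT_ne {i k : ι} (hik : i ≠ k) {p q} : flipT h A k i p q ↔ A i p q := by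
  simp [flipT, hik]

theorem flipT_eq {k : ι} {p q} : flipT h A k k p q ↔ ∃ r s, QuadT h A k r p s q := by
  simp [flipT]

theorem edge_flip {k : ι} {p q} (H : EdgeT h A p q) (H' : ¬ A k p q) :
    EdgeT h (flipT h A k) p q := by
  rcases H with H | H | ⟨i, H⟩
  · exact Or.inl H
  · exact Or.inr (Or.inl H)
  · refine Or.inr (Or.inr ⟨i, (flipT_ne ?_).2 H⟩)
    rintro rfl; exact H' H

theorem edge_flip_k {k : ι} {p q} (H : flipT h A k k p q) : EdgeT h (flipT h A k) p q :=
  Or.inr (Or.inr ⟨k, H⟩)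

theorem TriC.flip_rot (T : TriC h A) {k : ι} {p q} (H : flipT h A k k p q) :
    flipT h A k k q (p + 2 * h) := by
  obtain ⟨r, s, H⟩ := flipT_eq.1 H
  exact flipT_eq.2 ⟨s, r + 2 * h, H.rot T⟩

theorem TriC.flip_shift (T : TriC h A) {k : ι} {p q} (t : ℤ) (H : flipT h A k k p q) :
    flipT h A k k (p + t * h) (q + t * h) := by
  obtain ⟨r, s, H⟩ := flipT_eq.1 H
  exact flipT_eq.2 ⟨r + t * h, s + t * h, H.shift T t⟩

theorem TriC.flip_rot' (T : TriC h A) {k : ι} {p q} (H : flipT h A k k q (p + 2 * h)) :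
    flipT h A k k p q := by
  have := T.flip_shift (-2) (T.flip_rot H)
  convert this using 1 <;> ring

/-- an old edge crossing the new diagonal is the old diagonal -/
theorem TriC.cross_new (T : TriC h A) {k p m q m' b d} (H : QuadT h A k p m q m')
    (E : EdgeT h A b d) (h1 : m < b) (h2 : b < m') (h3 : m' < d) (h4 : d < m + 2 * h) :
    A k b d := by
  obtain ⟨g0, g1, g2, g3, g4, e1, e2, e3, e4⟩ := H
  have hb : b = q := by
    rcases lt_trichotomy b q with H | H | H
    · exact (T.edge_nc e2 E h1 H (by omega) (by omega)).elim
    · exact H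
    · exact (T.edge_nc e3 E H h2 (by omega) (by omega)).elim
  have hd : d = p + 2 * h := by
    rcases lt_trichotomy d (p + 2 * h) with H | H | H
    · exact (T.edge_nc E e4 h2 h3 H (by omega)).elim
    · exact H
    · exact (T.edge_nc E (T.edge_shift2 e1) (by omega) H h4 (by omega)).elim
  rw [hb, hd]; exact T.rot g0

theorem TriC.not_old (T : TriC h A) {k p q} (H : flipT h A k k p q) : ¬ EdgeT h A p q := by
  intro E
  obtain ⟨r, s, g0, g1, g2, g3, g4, e1, e2, e3, e4⟩ := flipT_eq.1 H
  exact T.edge_nc E (T.rot g0 |> fun x => Or.inr (Or.inr ⟨k, x⟩)) g2 g3 g4 (by omega)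

theorem TriC.flip_orb (T : TriC h A) {k p q r s} (H : flipT h A k k p q)
    (H' : flipT h A k k r s) :
    ∃ t : ℤ, (r = p + t * h ∧ s = q + t * h) ∨ (r = q + t * h ∧ s = p + 2 * h + t * h) := by
  obtain ⟨a, c, H⟩ := flipT_eq.1 H
  obtain ⟨a', c', H'⟩ := flipT_eq.1 H'
  obtain ⟨t, ⟨rfl, rfl⟩ | ⟨rfl, rfl⟩⟩ := T.orb H.1 H'.1
  · have := T.quad_uniq (H.shift T t) H'
    exact ⟨t, Or.inl ⟨this.1.symm, this.2.symm⟩⟩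
  · have := T.quad_uniq ((H.rot T).shift T t) H'
    exact ⟨t, Or.inr ⟨this.1.symm, this.2.symm⟩⟩

theorem TriC.flip_third (T : TriC h A) {k j p m q} (H : A j p q)
    (h1 : p < m) (h2 : m < q) (e1 : EdgeT h A p m) (e2 : EdgeT h A m q) :
    ∃ n, (p < n ∧ n < q ∧ EdgeT h (flipT h A k) p n ∧ EdgeT h (flipT h A k) n q) ∧
     ((¬ A k p m ∧ ¬ A k m q ∧ n = m) ∨ (A k p m ∧ ¬ A k m q ∧ QuadT h A k p n m q) ∨
      (¬ A k p m ∧ A k m q ∧ QuadT h A k m n q (p + 2 * h))) := by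
  have hlo := T.lo H
  have hhi := T.hi H
  have e0 : EdgeT h A q (p + 2 * h) := Or.inr (Or.inr ⟨j, T.rot H⟩)
  by_cases c1 : A k p m
  · have c2 : ¬ A k m q := fun H => T.adj c1 H (by omega)
    obtain ⟨n, n1, n2, f1, f2⟩ := T.third c1
    have Q : QuadT h A k p n m q := ⟨c1, n1, n2, h2, by omega, f1, f2, e2, e0⟩
    have S := T.side Q
    refine ⟨n, ⟨n1, by omega, edge_flip f1 S.1, edge_flip_k (flipT_eq.2 ⟨_, _, Q⟩)⟩, ?_⟩
    exact Or.inr (Or.inl ⟨c1, c2, Q⟩)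
  by_cases c2 : A k m q
  · obtain ⟨n, n1, n2, f1, f2⟩ := T.third c2
    have Q : QuadT h A k m n q (p + 2 * h) :=
      ⟨c2, n1, n2, by omega, by omega, f1, f2, e0, T.edge_shift2 e1⟩
    have S := T.side Q
    refine ⟨n, ⟨by omega, n2, edge_flip_k (T.flip_rot' (flipT_eq.2 ⟨_, _, Q⟩)),
      edge_flip f2 S.2.1⟩, ?_⟩
    exact Or.inr (Or.inr ⟨c1, c2, Q⟩)
  · exact ⟨m, ⟨h1, h2, edge_flip e1 c1, edge_flip e2 c2⟩, Or.inl ⟨c1, c2, rfl⟩⟩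

theorem TriC.flip (T : TriC h A) (k : ι) : TriC h (flipT h A k) where
  ne i := by
    by_cases hi : i = k
    · subst hi
      obtain ⟨p, q, H⟩ := T.ne i
      obtain ⟨m, m', H⟩ := T.quad H
      exact ⟨m, m', flipT_eq.2 ⟨p, q, H⟩⟩
    · obtain ⟨p, q, H⟩ := T.ne i
      exact ⟨p, q, (flipT_ne hi).2 H⟩
  lo {i p q} H := by
    by_cases hi : i = k
    · subst hi
      obtain ⟨r, s, H⟩ := flipT_eq.1 H
      obtain ⟨h0, h1, h2, h3, h4, -⟩ := H
      omega
    · exact T.lo ((flipT_ne hi).1 H)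
  hi {i p q} H := by
    by_cases hi : i = k
    · subst hi
      obtain ⟨r, s, H⟩ := flipT_eq.1 H
      obtain ⟨h0, h1, h2, h3, h4, -⟩ := H
      omega
    · exact T.hi ((flipT_ne hi).1 H)
  rot {i p q} H := by
    by_cases hi : i = k
    · subst hi
      exact T.flip_rot H
    · exact (flipT_ne hi).2 (T.rot ((flipT_ne hi).1 H))
  shift {i p q} t H := by
    by_cases hi : i = k
    · subst hi
      exact T.flip_shift t H
    · exact (flipT_ne hi).2 (T.shift t ((flipT_ne hi).1 H))
  orb {i p q r s} H H' := by
    by_cases hi : i = k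
    · subst hi
      exact T.flip_orb H H'
    · exact T.orb ((flipT_ne hi).1 H) ((flipT_ne hi).1 H')
  disj {i j p q} H H' := by
    by_cases hi : i = k <;> by_cases hj : j = k
    · rw [hi, hj]
    · subst hi
      exact (T.not_old H (Or.inr (Or.inr ⟨j, (flipT_ne hj).1 H'⟩))).elim
    · subst hj
      exact (T.not_old H' (Or.inr (Or.inr ⟨i, (flipT_ne hi).1 H⟩))).elim
    · exact T.disj ((flipT_ne hi).1 H) ((flipT_ne hj).1 H')
  nc {i j a b c d} H H' h1 h2 h3 h4 := by
    by_cases hi : i = k <;> by_cases hj : j = k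
    · subst hi; subst hj
      obtain ⟨t, H⟩ := T.flip_orb H H'
      have := mulcases t h (by omega)
      omega
    · subst hi
      obtain ⟨r, s, Q⟩ := flipT_eq.1 H
      have H' := (flipT_ne hj).1 H'
      exact hj (T.disj H' (T.cross_new Q (Or.inr (Or.inr ⟨j, H'⟩)) h1 h2 h3 h4))
    · subst hj
      obtain ⟨r, s, Q⟩ := flipT_eq.1 (T.flip_rot H')
      have Q := Q.rot T
      have H := T.rot ((flipT_ne hi).1 H)
      obtain ⟨r, s, Q⟩ := flipT_eq.1 H'
      exact hi (T.disj H (T.cross_new Q (Or.inr (Or.inr ⟨i, H⟩)) h2 h3 h4 (by omega)))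
    · exact T.nc ((flipT_ne hi).1 H) ((flipT_ne hj).1 H') h1 h2 h3 h4
  third {i p q} H := by
    by_cases hi : i = k
    · subst hi
      obtain ⟨r, s, Q⟩ := flipT_eq.1 H
      have S := T.side Q
      obtain ⟨h0, h1, h2, h3, h4, e1, e2, e3, e4⟩ := Q
      exact ⟨s, h2, h3, edge_flip e2 S.2.1, edge_flip e3 S.2.2.1⟩
    · have H := (flipT_ne hi).1 H
      obtain ⟨m, h1, h2, e1, e2⟩ := T.third H
      obtain ⟨n, ⟨h1, h2, h3, h4⟩, -⟩ := T.flip_third H h1 h2 e1 e2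
      exact ⟨n, h1, h2, h3, h4⟩

/-- Quadrilaterals in the flipped triangulation. -/
theorem TriC.flip_quad_k (T : TriC h A) {k a b c d} (Q : QuadT h (flipT h A k) k a b c d) :
    ∃ r, d = r + 2 * h ∧ QuadT h A k r a b c := by
  obtain ⟨r, s, Q'⟩ := flipT_eq.1 Q.1
  have S := T.side Q'
  have Q'' : QuadT h (flipT h A k) k a s c (r + 2 * h) := by
    obtain ⟨h0, h1, h2, h3, h4, e1, e2, e3, e4⟩ := Q'
    exact ⟨Q.1, h2, h3, h4, by omega, edge_flip e2 S.2.1, edge_flip e3 S.2.2.1,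
      edge_flip e4 S.2.2.2, (T.flip k).edge_shift2 (edge_flip e1 S.1)⟩
  obtain ⟨rfl, rfl⟩ := (T.flip k).quad_uniq Q Q''
  exact ⟨r, rfl, Q'⟩

theorem TriC.flip_tri (T : TriC h A) {k j p m n q} (H : A j p q)
    (h1 : p < m) (h2 : m < q) (e1 : EdgeT h A p m) (e2 : EdgeT h A m q)
    (h1' : p < n) (h2' : n < q) (e1' : EdgeT h (flipT h A k) p n)
    (e2' : EdgeT h (flipT h A k) n q) :
     ((¬ A k p m ∧ ¬ A k m q ∧ n = m) ∨ (A k p m ∧ ¬ A k m q ∧ QuadT h A k p n m q) ∨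
      (¬ A k p m ∧ A k m q ∧ QuadT h A k m n q (p + 2 * h))) := by
  obtain ⟨n', ⟨a, b, c, d⟩, H'⟩ := T.flip_third H h1 h2 e1 e2
  have := T.hi H
  have : n = n' := (T.flip k).uniq (by omega) e1' e2' c d h1' h2' a b
  rw [this]; exact H'

/-- Invariant functions on edges. -/
structure InvT (h : ℤ) (f : ℤ → ℤ → ℤ) : Prop where
  rot : ∀ p q, f q (p + 2 * h) = f p q
  shift : ∀ p q, f (p + h) (q + h) = f p q

def XT (h : ℤ) (f : ℤ → ℤ → ℤ) (p m q m' : ℤ) : ℤ :=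
  f p m - f m q + f q m' - f m' (p + 2 * h)

def PtolT {ι : Type} (h : ℤ) (A : ι → ℤ → ℤ → Prop) (k : ι) (f : ℤ → ℤ → ℤ) : Prop :=
  ∀ p m q m', QuadT h A k p m q m' →
    f p q + f m m' = min (f p m + f q m') (f m q + f m' (p + 2 * h))

open Classical in
noncomputable def indT {ι : Type} (A : ι → ℤ → ℤ → Prop) (i : ι) (p q : ℤ) : ℤ := if A i p q then 1 else 0

theorem InvT.shift_mul {f} (F : InvT h f) (t p q : ℤ) : f (p + t * h) (q + t * h) = f p q := by
  induction t using Int.induction_on with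
  | zero => simp
  | succ i ih => rw [← ih, ← F.shift (p + i * h)]; congr 1 <;> ring
  | pred i ih => rw [← ih, ← F.shift (p + (-i - 1) * h)]; congr 1 <;> ring

theorem InvT.shift2 {f} (F : InvT h f) (p q : ℤ) : f (p + 2 * h) (q + 2 * h) = f p q :=
  F.shift_mul 2 p q

theorem TriC.indInv (T : TriC h A) (i : ι) : InvT h (indT A i) where
  rot p q := by
    have : A i q (p + 2 * h) ↔ A i p q := ⟨T.rot', T.rot⟩
    by_cases H : A i p q <;> simp [indT, this, H]
  shift p q := by
    have : A i (p + h) (q + h) ↔ A i p q := by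
      constructor
      · intro H; have := T.shift (-1) H; convert this using 1 <;> ring
      · intro H; have := T.shift 1 H; convert this using 1 <;> ring
    by_cases H : A i p q <;> simp [indT, this, H]

/-- the value of `X` does not depend on the lift -/
theorem TriC.X_indep (T : TriC h A) {f} (F : InvT h f) {j p m q m' r n s n'}
    (Q : QuadT h A j p m q m') (Q' : QuadT h A j r n s n') :
    XT h f r n s n' = XT h f p m q m' := by
  obtain ⟨t, ⟨rfl, rfl⟩ | ⟨rfl, rfl⟩⟩ := T.orb Q.1 Q'.1
  · obtain ⟨rfl, rfl⟩ := T.quad_uniq (Q.shift T t) Q'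
    unfold XT
    have e : p + t * h + 2 * h = (p + 2 * h) + t * h := by ring
    simp only [e, F.shift_mul]
  · obtain ⟨rfl, rfl⟩ := T.quad_uniq ((Q.rot T).shift T t) Q'
    unfold XT
    have e : q + t * h + 2 * h = (q + 2 * h) + t * h := by ring
    simp only [e, F.shift_mul]
    ring

theorem sgn1 (x : ℤ) : x.sign * max (x * 1) 0 = max x 0 := by
  rcases lt_trichotomy x 0 with h | h | h
  · rw [Int.sign_eq_neg_one_of_neg h]; omega
  · subst h; simp
  · rw [Int.sign_eq_one_of_pos h]; omega

theorem sgn2 (x : ℤ) : x.sign * max (x * (-1)) 0 = min x 0 := by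
  rcases lt_trichotomy x 0 with h | h | h
  · rw [Int.sign_eq_neg_one_of_neg h]; omega
  · subst h; simp
  · rw [Int.sign_eq_one_of_pos h]; omega

theorem sgn_add (x y z : ℤ) (H : 0 ≤ y ∧ 0 ≤ z ∨ y ≤ 0 ∧ z ≤ 0) :
    x.sign * max (x * (y + z)) 0 = x.sign * max (x * y) 0 + x.sign * max (x * z) 0 := by
  rw [← mul_add]; congr 1
  rcases le_total 0 x with hx | hx <;> rcases H with ⟨h1, h2⟩ | ⟨h1, h2⟩
  · have := mul_nonneg hx h1; have := mul_nonneg hx h2; rw [mul_add]; omega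
  · have := mul_nonneg hx (neg_nonneg.2 h1); have := mul_nonneg hx (neg_nonneg.2 h2)
    rw [mul_neg] at *; rw [mul_add]; omega
  · have := mul_nonneg (neg_nonneg.2 hx) h1; have := mul_nonneg (neg_nonneg.2 hx) h2
    rw [neg_mul] at *; rw [mul_add]; omega
  · have := mul_nonneg_of_nonpos_of_nonpos hx h1
    have := mul_nonneg_of_nonpos_of_nonpos hx h2; rw [mul_add]; omega

theorem TriC.half (T : TriC h A) {f} (F : InvT h f) {k j : ι} {p m n q : ℤ} {x : ℤ}
    (hx : ∀ p m q m', QuadT h A k p m q m' → XT h f p m q m' = x) (P : PtolT h A k f)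
    (H : A j p q)
    (h1 : p < m) (h2 : m < q) (e1 : EdgeT h A p m) (e2 : EdgeT h A m q)
    (h1' : p < n) (h2' : n < q) (e1' : EdgeT h (flipT h A k) p n)
    (e2' : EdgeT h (flipT h A k) n q) :
    f p n - f n q = f p m - f m q +
      x.sign * max (x * (indT A k p m - indT A k m q)) 0 := by
  rcases T.flip_tri H h1 h2 e1 e2 h1' h2' e1' e2' with ⟨a, b, rfl⟩ | ⟨a, b, Q⟩ | ⟨a, b, Q⟩
  · simp [indT, a, b]
  · have := hx _ _ _ _ Q
    have := P _ _ _ _ Q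
    simp only [indT, a, b, if_true, if_false, sub_zero, sgn1]
    unfold XT at *
    omega
  · have := hx _ _ _ _ Q
    have := P _ _ _ _ Q
    simp only [indT, a, b, if_true, if_false, zero_sub, sgn2]
    unfold XT at *
    simp only [F.rot] at *
    omega

theorem TriC.mut_col (T : TriC h A) {f} (F : InvT h f) {k j : ι} {x y b : ℤ}
    (hx : ∀ p m q m', QuadT h A k p m q m' → XT h f p m q m' = x) (P : PtolT h A k f)
    (hy : ∀ p m q m', QuadT h A j p m q m' → XT h f p m q m' = y)
    (hb : ∀ p m q m', QuadT h A j p m q m' → XT h (indT A k) p m q m' = b)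
    (hjk : j ≠ k) {p n q n' : ℤ} (Q : QuadT h (flipT h A k) j p n q n') :
    XT h f p n q n' = y + x.sign * max (x * b) 0 := by
  obtain ⟨g0, g1, g2, g3, g4, u1, u2, u3, u4⟩ := Q
  rw [flipT_ne hjk] at g0
  obtain ⟨m, m', Q⟩ := T.quad g0
  have N := T.nocancel (k := k) Q
  have Y := hy _ _ _ _ Q
  have Bb := hb _ _ _ _ Q
  obtain ⟨g0, v1, v2, v3, v4, w1, w2, w3, w4⟩ := Q
  have c1 := T.half F hx P g0 v1 v2 w1 w2 g1 g2 u1 u2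
  have c2 := T.half F hx P (T.rot g0) v3 v4 w3 w4 g3 g4 u3 u4
  have : XT h f p n q n' = (f p n - f n q) + (f q n' - f n' (p + 2 * h)) := by unfold XT; ring
  rw [this, c1, c2, ← Y, ← Bb]
  have : XT h (indT A k) p m q m' = (indT A k p m - indT A k m q) +
    (indT A k q m' - indT A k m' (p + 2 * h)) := by unfold XT; ring
  rw [this, sgn_add]
  · unfold XT; ring
  · simp only [indT]
    split_ifs <;> first | omega | (exfalso; tauto)

theorem TriC.mut_k (T : TriC h A) {f} (F : InvT h f) {k : ι} {x : ℤ}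
    (hx : ∀ p m q m', QuadT h A k p m q m' → XT h f p m q m' = x)
    {p n q n' : ℤ} (Q : QuadT h (flipT h A k) k p n q n') :
    XT h f p n q n' = - x := by
  obtain ⟨r, rfl, Q'⟩ := T.flip_quad_k Q
  rw [← hx _ _ _ _ Q']
  unfold XT
  rw [F.shift2]; ring

theorem TriC.mut_row (T : TriC h A) {k j : ι} {b : ℤ}
    (hb : ∀ p m q m', QuadT h A j p m q m' → XT h (indT A k) p m q m' = b)
    {p n q n' : ℤ} (Q : QuadT h (flipT h A k) j p n q n') :
    XT h (indT (flipT h A k) k) p n q n' = - b := by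
  by_cases hjk : j = k
  · subst hjk
    have S := (T.flip j).side Q
    obtain ⟨r, rfl, Q'⟩ := T.flip_quad_k Q
    have S' := T.side Q'
    rw [← hb _ _ _ _ Q']
    simp [XT, indT, S, S']
  · obtain ⟨g0, g1, g2, g3, g4, u1, u2, u3, u4⟩ := Q
    rw [flipT_ne hjk] at g0
    obtain ⟨m, m', Q⟩ := T.quad g0
    rw [← hb _ _ _ _ Q]
    have key : ∀ {p m n q}, A j p q → p < m → m < q → EdgeT h A p m → EdgeT h A m q →
        p < n → n < q → EdgeT h (flipT h A k) p n → EdgeT h (flipT h A k) n q →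
        indT (flipT h A k) k p n - indT (flipT h A k) k n q =
          - (indT A k p m - indT A k m q) := by
      intro p m n q H h1 h2 e1 e2 h1' h2' e1' e2'
      rcases T.flip_tri H h1 h2 e1 e2 h1' h2' e1' e2' with ⟨a, b, rfl⟩ | ⟨a, b, Q⟩ | ⟨a, b, Q⟩
      · have k1 : ¬ flipT h A k k p n := fun H => T.not_old H e1
        have k2 : ¬ flipT h A k k n q := fun H => T.not_old H e2
        simp [indT, a, b, k1, k2]
      · have k1 : ¬ flipT h A k k p n := fun H => T.not_old H Q.2.2.2.2.2.1
        have k2 : flipT h A k k n q := flipT_eq.2 ⟨_, _, Q⟩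
        simp [indT, a, b, k1, k2]
      · have k1 : ¬ flipT h A k k n q := fun H => T.not_old H Q.2.2.2.2.2.2.1
        have k2 : flipT h A k k p n := T.flip_rot' (flipT_eq.2 ⟨_, _, Q⟩)
        simp [indT, a, b, k1, k2]
    obtain ⟨g0, v1, v2, v3, v4, w1, w2, w3, w4⟩ := Q
    have c1 := key g0 v1 v2 w1 w2 g1 g2 u1 u2
    have c2 := key (T.rot g0) v3 v4 w3 w4 g3 g4 u3 u4
    unfold XT
    omega

theorem TriC.ptol_ind (T : TriC h A) {i k : ι} (hik : i ≠ k) : PtolT h A k (indT A i) := by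
  intro p m q m' Q
  have N := T.nocancel (k := i) Q
  have n1 : ¬ A i p q := fun H => hik (T.disj H Q.1)
  have n2 : ¬ A i m m' := fun H => T.not_old (flipT_eq.2 ⟨_, _, Q⟩) (Or.inr (Or.inr ⟨i, H⟩))
  simp only [indT, n1, n2, if_false]
  split_ifs <;> first | omega | (exfalso; tauto)

/-- The triangulation `A` realizes the matrix `b`. -/
def RealT {ι : Type} (h : ℤ) (A : ι → ℤ → ℤ → Prop) (b : ι → ι → ℤ) : Prop :=
  ∀ i j p m q m', QuadT h A j p m q m' → XT h (indT A i) p m q m' = b i j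

end TriSec

noncomputable section

section CutSec

def cutT (h p q x : ℤ) : Prop := ∃ t : ℤ, p + t * (2 * h) ≤ x ∧ x < q + t * (2 * h)

open Classical in
def delT (χ : ℤ → Prop) (u v : ℤ) : ℤ := if (χ u ↔ χ v) then 0 else 1

def lamT (h p q u v : ℤ) : ℤ :=
  -(delT (cutT h p q) u v + delT (cutT h (p + h) (q + h)) u v)

theorem delT_symm (χ : ℤ → Prop) (u v : ℤ) : delT χ u v = delT χ v u := by
  unfold delT; congr 1; exact propext ⟨Iff.symm, Iff.symm⟩

theorem delT_congr {χ χ' : ℤ → Prop} {u v u' v' : ℤ} (h1 : χ u ↔ χ' u') (h2 : χ v ↔ χ' v') :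
    delT χ u v = delT χ' u' v' := by
  unfold delT; congr 1; exact propext (by rw [h1, h2])

theorem cutT_per (h p q x : ℤ) : cutT h p q (x + 2 * h) ↔ cutT h p q x := by
  constructor
  · rintro ⟨t, h1, h2⟩
    refine ⟨t - 1, ?_, ?_⟩ <;> rw [sub_mul] <;> omega
  · rintro ⟨t, h1, h2⟩
    refine ⟨t + 1, ?_, ?_⟩ <;> rw [add_mul] <;> omega

theorem cutT_sh (h p q x : ℤ) : cutT h (p + h) (q + h) (x + h) ↔ cutT h p q x := by
  constructor <;> rintro ⟨t, h1, h2⟩ <;> exact ⟨t, by omega, by omega⟩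

theorem cutT_sh' (h p q x : ℤ) : cutT h p q (x + h) ↔ cutT h (p + h) (q + h) x := by
  rw [← cutT_sh h p q (x + h), ← cutT_per h (p + h) (q + h) x]
  ring_nf

theorem lamT_inv (h p q : ℤ) : InvT h (lamT h p q) where
  rot u v := by
    unfold lamT
    rw [delT_symm _ v, delT_symm _ v]
    rw [delT_congr (cutT_per h p q u) Iff.rfl,
      delT_congr (cutT_per h (p + h) (q + h) u) Iff.rfl]
  shift u v := by
    unfold lamT
    rw [delT_congr (cutT_sh' h p q u) (cutT_sh' h p q v),
      delT_congr (cutT_sh h p q u) (cutT_sh h p q v)]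
    ring

variable {ι : Type} {h : ℤ} {A : ι → ℤ → ℤ → Prop}

theorem exists_window (a p h : ℤ) (hh : 0 < h) :
    ∃ t : ℤ, a < p + t * (2 * h) ∧ p + t * (2 * h) ≤ a + 2 * h := by
  refine ⟨-((p - a - 1) / (2 * h)), ?_⟩
  have h1 := Int.mul_ediv_add_emod (p - a - 1) (2 * h)
  have h2 := Int.emod_nonneg (p - a - 1) (b := 2 * h) (by omega)
  have h3 := Int.emod_lt_of_pos (p - a - 1) (b := 2 * h) (by omega)
  rw [neg_mul, mul_comm _ (2 * h)]
  omega

theorem TriC.window (T : TriC h A) {i p q} (H : A i p q) (a : ℤ) :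
    ∃ r s, A i r s ∧ a < r ∧ r < s ∧ s ≤ a + 2 * h ∧
      ((∀ x, a ≤ x → x < a + 2 * h → (cutT h p q x ↔ r ≤ x ∧ x < s)) ∨
       (∀ x, a ≤ x → x < a + 2 * h → (cutT h p q x ↔ ¬ (r ≤ x ∧ x < s)))) := by
  have hlo := T.lo H
  have hhi := T.hi H
  have hh : 0 < h := by omega
  obtain ⟨t, t1, t2⟩ := exists_window a p h hh
  have cut_iff : ∀ x, a ≤ x → x < a + 2 * h → (cutT h p q x ↔
      (p + t * (2 * h) ≤ x ∧ x < q + t * (2 * h)) ∨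
      (p + t * (2 * h) ≤ x + 2 * h ∧ x + 2 * h < q + t * (2 * h))) := by
    intro x hx1 hx2
    constructor
    · rintro ⟨u, u1, u2⟩
      have hu : u * (2 * h) = t * (2 * h) + 2 * ((u - t) * h) := by ring
      have := mulcases (u - t) h hh
      omega
    · rintro (H | H)
      · exact ⟨t, H⟩
      · refine ⟨t - 1, ?_⟩
        rw [sub_mul]; omega
  by_cases c : q + t * (2 * h) ≤ a + 2 * h
  · refine ⟨p + t * (2 * h), q + t * (2 * h), ?_, t1, by omega, c, Or.inl ?_⟩
    · have := T.shift (2 * t) H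
      convert this using 1 <;> ring
    · intro x hx1 hx2
      rw [cut_iff x hx1 hx2]; omega
  · refine ⟨q + t * (2 * h) - 2 * h, p + t * (2 * h), ?_, by omega, by omega, t2, Or.inr ?_⟩
    · have := T.shift (2 * t - 2) (T.rot H)
      convert this using 1 <;> ring
    · intro x hx1 hx2
      rw [cut_iff x hx1 hx2]; omega

/-- Pattern of a cut on a quadrilateral. -/
theorem TriC.cut_ptol (T : TriC h A) {i p q} (H : A i p q) {a b c d : ℤ} (h1 : a < b) (h2 : b < c)
    (h3 : c < d) (h4 : d < a + 2 * h) (χ : ℤ → Prop) (hχ : χ = cutT h p q) :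
    delT χ a c + delT χ b d = max (delT χ a b + delT χ c d) (delT χ b c + delT χ d (a + 2 * h)) := by
  obtain ⟨r, s, -, w1, w2, w3, w4⟩ := T.window H a
  have per : χ (a + 2 * h) ↔ χ a := by rw [hχ]; exact cutT_per h p q a
  rw [← hχ] at w4
  unfold delT
  rw [per]
  rcases w4 with w | w
  all_goals
    have wa := w a le_rfl (by omega)
    have wb := w b (by omega) (by omega)
    have wc := w c (by omega) (by omega)
    have wd := w d (by omega) (by omega)
    by_cases ca : χ a <;> by_cases cb : χ b <;> by_cases cc : χ c <;> by_cases cd : χ d <;>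
      simp [ca, cb, cc, cd] at wa wb wc wd ⊢
    all_goals omega

def XC (h p q a b c d : ℤ) : ℤ := XT h (fun u v => - delT (cutT h p q) u v) a b c d

theorem XT_lam (h p q a b c d : ℤ) : XT h (lamT h p q) a b c d =
    XC h p q a b c d + XC h (p + h) (q + h) a b c d := by
  unfold XC XT lamT; ring

theorem TriC.cut_pos (T : TriC h A) {i p q} (H : A i p q) {a b c d : ℤ} (h1 : a < b) (h2 : b < c)
    (h3 : c < d) (h4 : d < a + 2 * h) :
    (0 < XC h p q a b c d → ∃ r s, A i r s ∧ b < r ∧ r ≤ c ∧ d < s ∧ s ≤ a + 2 * h) ∧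
    (XC h p q a b c d < 0 → ∃ r s, A i r s ∧ a < r ∧ r ≤ b ∧ c < s ∧ s ≤ d) := by
  obtain ⟨r, s, H', w1, w2, w3, w4⟩ := T.window H a
  unfold XC XT
  simp only [delT]
  rw [cutT_per]
  rcases w4 with w | w
  all_goals
    have wa := w a le_rfl (by omega)
    have wb := w b (by omega) (by omega)
    have wc := w c (by omega) (by omega)
    have wd := w d (by omega) (by omega)
    by_cases ca : cutT h p q a <;> by_cases cb : cutT h p q b <;> by_cases cc : cutT h p q c <;>
      by_cases cd : cutT h p q d <;>
      simp [ca, cb, cc, cd] at wa wb wc wd ⊢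
    all_goals first | omega | exact ⟨r, s, H', by omega, by omega, by omega, by omega⟩

theorem TriC.cut_compat (T : TriC h A) {i p q j r s} (H : A i p q) (H' : A j r s)
    {a b c d : ℤ} (h1 : a < b) (h2 : b < c) (h3 : c < d) (h4 : d < a + 2 * h) :
    ¬ (0 < XC h p q a b c d ∧ XC h r s a b c d < 0) := by
  rintro ⟨g1, g2⟩
  obtain ⟨x, y, X, x1, x2, x3, x4⟩ := (T.cut_pos H h1 h2 h3 h4).1 g1
  obtain ⟨z, w, Z, z1, z2, z3, z4⟩ := (T.cut_pos H' h1 h2 h3 h4).2 g2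
  exact T.nc Z X (by omega) (by omega) (by omega) (by omega)

theorem TriC.shift1 (T : TriC h A) {i p q} (H : A i p q) : A i (p + h) (q + h) := by
  have := T.shift 1 H
  convert this using 1 <;> ring

theorem TriC.lam_coh (T : TriC h A) {i p q j r s} (H : A i p q) (H' : A j r s)
    {a b c d : ℤ} (h1 : a < b) (h2 : b < c) (h3 : c < d) (h4 : d < a + 2 * h) :
    ¬ (0 < XT h (lamT h p q) a b c d ∧ XT h (lamT h r s) a b c d < 0) := by
  rw [XT_lam, XT_lam]
  have k1 := T.cut_compat H H' h1 h2 h3 h4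
  have k2 := T.cut_compat H (T.shift1 H') h1 h2 h3 h4
  have k3 := T.cut_compat (T.shift1 H) H' h1 h2 h3 h4
  have k4 := T.cut_compat (T.shift1 H) (T.shift1 H') h1 h2 h3 h4
  omega

theorem TriC.lam_ptol (T : TriC h A) {i p q} (H : A i p q) {κ : Type} {A' : κ → ℤ → ℤ → Prop}
    (k : κ) : PtolT h A' k (lamT h p q) := by
  rintro a b c d ⟨-, h1, h2, h3, h4, -⟩
  have k1 := T.cut_ptol H h1 h2 h3 h4 _ rfl
  have k2 := T.cut_ptol (T.shift1 H) h1 h2 h3 h4 _ rfl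
  have k3 := T.cut_compat H (T.shift1 H) h1 h2 h3 h4
  have k4 := T.cut_compat (T.shift1 H) H h1 h2 h3 h4
  unfold XC XT at k3 k4
  beta_reduce at k3 k4
  unfold lamT
  omega

theorem TriC.cut_init (T : TriC h A) {i j p q a b c d} (H : A i p q) (Q : QuadT h A j a b c d) :
    0 ≤ XC h p q a b c d ∧ (i ≠ j → XC h p q a b c d = 0) := by
  obtain ⟨g0, h1, h2, h3, h4, e1, e2, e3, e4⟩ := Q
  have P := T.cut_pos H h1 h2 h3 h4
  have n : ¬ XC h p q a b c d < 0 := by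
    intro g
    obtain ⟨z, w, Z, z1, z2, z3, z4⟩ := P.2 g
    exact T.nc g0 Z (by omega) (by omega) (by omega) (by omega)
  refine ⟨by omega, fun hij => ?_⟩
  by_contra g
  obtain ⟨r, s, X, x1, x2, x3, x4⟩ := P.1 (by omega)
  have E : EdgeT h A r s := Or.inr (Or.inr ⟨i, X⟩)
  have hr : r = c := by
    by_contra hr
    exact T.edge_nc e2 E x1 (by omega) (by omega) (by omega)
  have hs : s = a + 2 * h := by
    by_contra hs
    exact T.edge_nc E e4 (by omega) x3 (by omega) (by omega)
  rw [hr, hs] at X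
  exact hij (T.disj X (T.rot g0))

theorem cut_self {i p m q m'} (Q : QuadT h A i p m q m') :
    0 < XC h p q p m q m' := by
  obtain ⟨g0, h1, h2, h3, h4, e1, e2, e3, e4⟩ := Q
  have c1 : cutT h p q p := ⟨0, by omega, by omega⟩
  have c2 : cutT h p q m := ⟨0, by omega, by omega⟩
  have c : ∀ x, q ≤ x → x < p + 2 * h → ¬ cutT h p q x := by
    rintro x x1 x2 ⟨t, t1, t2⟩
    have := mulcases t h (by omega)
    have : t * (2 * h) = 2 * (t * h) := by ring
    omega
  have c3 := c q le_rfl (by omega)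
  have c4 := c m' (by omega) (by omega)
  unfold XC XT delT
  simp [cutT_per, c1, c2, c3, c4]

/-- initial values of the laminations -/
theorem TriC.lam_init (T : TriC h A) {i p q} (H : A i p q) :
    ∃ w : ℤ, 0 < w ∧ ∀ j a b c d, QuadT h A j a b c d →
      (j = i → XT h (lamT h p q) a b c d = w) ∧ (j ≠ i → XT h (lamT h p q) a b c d = 0) := by
  obtain ⟨m, m', Q⟩ := T.quad H
  refine ⟨XT h (lamT h p q) p m q m', ?_, ?_⟩
  · rw [XT_lam]
    have := cut_self Q
    have := (T.cut_init (T.shift1 H) Q).1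
    omega
  · intro j a b c d Q'
    refine ⟨fun hj => ?_, fun hj => ?_⟩
    · subst hj
      exact T.X_indep (lamT_inv h p q) Q Q'
    · rw [XT_lam, (T.cut_init H Q').2 hj.symm, (T.cut_init (T.shift1 H) Q').2 hj.symm]
      rfl

end CutSec
end

noncomputable section

section InitSec

theorem TriC.reindex {ι κ : Type} {h : ℤ} {A : ι → ℤ → ℤ → Prop} (T : TriC h A) (e : κ ≃ ι) :
    TriC h (fun i => A (e i)) where
  ne i := T.ne (e i)
  lo H := T.lo H
  hi H := T.hi H
  rot H := T.rot H
  shift t H := T.shift t H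
  orb H H' := T.orb H H'
  disj H H' := e.injective (T.disj H H')
  nc H H' := T.nc H H'
  third {i p q} H := by
    have key : ∀ p q, EdgeT h A p q → EdgeT h (fun i => A (e i)) p q := by
      rintro p q (H | H | ⟨i, H⟩)
      · exact Or.inl H
      · exact Or.inr (Or.inl H)
      · exact Or.inr (Or.inr ⟨e.symm i, by simpa using H⟩)
    obtain ⟨m, h1, h2, e1, e2⟩ := T.third H
    exact ⟨m, h1, h2, key _ _ e1, key _ _ e2⟩

def lI (ε : ℕ → Prop) [DecidablePred ε] : ℕ → ℤ
  | 0 => 0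
  | i + 1 => if ε i then lI ε i else lI ε i - 1

def AI (ε : ℕ → Prop) [DecidablePred ε] (n : ℕ) (i : Fin n) (p q : ℤ) : Prop :=
  ∃ t : ℤ, (p = lI ε i + t * (n + 1) ∧ q = lI ε i + (i.val + 2) + t * (n + 1)) ∨
    (p = lI ε i + (i.val + 2) + t * (n + 1) ∧ q = lI ε i + 2 * (n + 1) + t * (n + 1))

variable (ε : ℕ → Prop) [DecidablePred ε]

theorem lI_mono (i k : ℕ) : lI ε (i + k) ≤ lI ε i ∧ lI ε i ≤ lI ε (i + k) + k := by
  induction k with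
  | zero => simp
  | succ k ih =>
    rw [← add_assoc, lI]
    push_cast
    split_ifs <;> omega

theorem lI_mono' {i j : ℕ} (hij : i ≤ j) : lI ε j ≤ lI ε i ∧ lI ε i + i ≤ lI ε j + j := by
  obtain ⟨k, rfl⟩ := Nat.exists_eq_add_of_le hij
  have := lI_mono ε i k
  push_cast
  omega

variable {n : ℕ}

theorem AI.fst (i : Fin n) : AI ε n i (lI ε i) (lI ε i + (i.val + 2)) :=
  ⟨0, Or.inl ⟨by ring, by ring⟩⟩

theorem AI.snd (i : Fin n) : AI ε n i (lI ε i + (i.val + 2)) (lI ε i + 2 * (n + 1)) :=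
  ⟨0, Or.inr ⟨by ring, by ring⟩⟩

theorem AI.shift {i : Fin n} {p q : ℤ} (t : ℤ) (H : AI ε n i p q) :
    AI ε n i (p + t * (n + 1)) (q + t * (n + 1)) := by
  obtain ⟨u, ⟨rfl, rfl⟩ | ⟨rfl, rfl⟩⟩ := H
  · exact ⟨u + t, Or.inl ⟨by ring, by ring⟩⟩
  · exact ⟨u + t, Or.inr ⟨by ring, by ring⟩⟩

theorem edgeI_shift {p q : ℤ} (t : ℤ) (H : EdgeT (n + 1) (AI ε n) p q) :
    EdgeT (n + 1) (AI ε n) (p + t * (n + 1)) (q + t * (n + 1)) := by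
  rcases H with H | H | ⟨i, H⟩
  · left; omega
  · right; left; omega
  · exact Or.inr (Or.inr ⟨i, AI.shift ε t H⟩)

/-- inner triangle at arc `j` -/
theorem innerI (j : Fin n) :
    ∃ m, lI ε j < m ∧ m < lI ε j + (j.val + 2) ∧
      ((j.val = 0 ∧ m = lI ε j + 1) ∨
       (∃ i : Fin n, i.val + 1 = j.val ∧ ε i.val ∧ AI ε n i (lI ε j) m ∧
          lI ε j + (j.val + 2) = m + 1) ∨
       (∃ i : Fin n, i.val + 1 = j.val ∧ ¬ ε i.val ∧ m = lI ε j + 1 ∧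
          AI ε n i m (lI ε j + (j.val + 2)))) := by
  obtain ⟨j, hj⟩ := j
  cases j with
  | zero => exact ⟨lI ε 0 + 1, by simp, by simp, Or.inl ⟨rfl, rfl⟩⟩
  | succ i =>
    have F := AI.fst ε (⟨i, by omega⟩ : Fin n)
    simp only at F
    by_cases c : ε i
    · refine ⟨lI ε i + (i + 2), ?_, ?_, Or.inr (Or.inl ⟨⟨i, by omega⟩, rfl, c, ?_, ?_⟩)⟩
      all_goals simp only [lI, c, if_true]
      · omega
      · push_cast; omega
      · exact F
      · push_cast; ring
    · refine ⟨lI ε i, ?_, ?_, Or.inr (Or.inr ⟨⟨i, by omega⟩, rfl, c, ?_, ?_⟩)⟩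
      all_goals simp only [lI, c, if_false]
      · omega
      · push_cast; omega
      · ring
      · convert F using 1; push_cast; ring

theorem outerI (j : Fin n) (hj : j.val + 1 < n) :
    ∃ m, lI ε j + (j.val + 2) < m ∧ m < lI ε j + 2 * (n + 1) ∧
       (∃ i : Fin n, i.val = j.val + 1 ∧ ((ε j.val ∧ m = lI ε j + (j.val + 2) + 1 ∧
          AI ε n i m (lI ε j + 2 * (n + 1))) ∨
       (¬ ε j.val ∧ AI ε n i (lI ε j + (j.val + 2)) m ∧ lI ε j + 2 * (n + 1) = m + 1))) := by
  have F := AI.snd ε (⟨j.val + 1, hj⟩ : Fin n)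
  simp only [lI] at F
  by_cases c : ε j.val
  · simp only [c, if_true] at F
    refine ⟨lI ε j + (j.val + 2) + 1, by omega, by omega, ⟨j.val + 1, hj⟩, rfl, Or.inl ⟨c, rfl, ?_⟩⟩
    convert F using 1
    push_cast; ring
  · simp only [c, if_false] at F
    refine ⟨lI ε j + 2 * (n + 1) - 1, by omega, by omega, ⟨j.val + 1, hj⟩, rfl,
      Or.inr ⟨c, ?_, by ring⟩⟩
    convert F using 1
    · push_cast; ring
    · ring

theorem triI : TriC ((n : ℤ) + 1) (AI ε n) where
  ne i := ⟨_, _, AI.fst ε i⟩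
  lo {i p q} H := by
    obtain ⟨t, H⟩ := H
    have := i.2
    omega
  hi {i p q} H := by
    obtain ⟨t, H⟩ := H
    have := i.2
    omega
  rot {i p q} H := by
    obtain ⟨t, ⟨rfl, rfl⟩ | ⟨rfl, rfl⟩⟩ := H
    · exact ⟨t, Or.inr ⟨by ring, by ring⟩⟩
    · exact ⟨t + 2, Or.inl ⟨by ring, by ring⟩⟩
  shift t H := AI.shift ε t H
  orb {i p q r s} H H' := by
    obtain ⟨t, ⟨rfl, rfl⟩ | ⟨rfl, rfl⟩⟩ := H <;> obtain ⟨u, ⟨rfl, rfl⟩ | ⟨rfl, rfl⟩⟩ := H'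
    · exact ⟨u - t, Or.inl ⟨by ring, by ring⟩⟩
    · exact ⟨u - t, Or.inr ⟨by ring, by ring⟩⟩
    · exact ⟨u - t - 2, Or.inr ⟨by ring, by ring⟩⟩
    · exact ⟨u - t, Or.inl ⟨by ring, by ring⟩⟩
  disj {i j p q} H H' := by
    obtain ⟨t, H⟩ := H
    obtain ⟨u, H'⟩ := H'
    have := i.2
    have := j.2
    apply Fin.ext
    omega
  nc {i j a b c d} H H' h1 h2 h3 h4 := by
    have hi := i.2
    have hj := j.2
    have m1 := lI_mono' ε (i := i) (j := n - 1) (by omega)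
    have m2 := lI_mono' ε (i := j) (j := n - 1) (by omega)
    have m3 : (lI ε j ≤ lI ε i ∧ lI ε i + i.val ≤ lI ε j + j.val) ∨
        (lI ε i ≤ lI ε j ∧ lI ε j + j.val ≤ lI ε i + i.val) := by
      rcases le_total i.val j.val with H | H
      · exact Or.inl (lI_mono' ε H)
      · exact Or.inr (lI_mono' ε H)
    have hn : (((n - 1 : ℕ)) : ℤ) = n - 1 := by omega
    rw [hn] at m1 m2
    obtain ⟨t, H⟩ := H
    obtain ⟨u, H'⟩ := H'
    generalize lI ε (n - 1) = L at *
    generalize lI ε i = x at *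
    generalize lI ε j = y at *
    have M := mulcases (u - t) (n + 1) (by omega)
    rw [sub_mul] at M
    rcases H with H | H <;> rcases H' with H' | H' <;> omega
  third {i p q} H := by
    have fstE : ∃ m, lI ε i < m ∧ m < lI ε i + (i.val + 2) ∧
        EdgeT (n + 1) (AI ε n) (lI ε i) m ∧ EdgeT (n + 1) (AI ε n) m (lI ε i + (i.val + 2)) := by
      obtain ⟨m, h1, h2, ⟨e1, e2⟩ | ⟨i', e1, e2, e3, e4⟩ | ⟨i', e1, e2, e3, e4⟩⟩ := innerI ε i
      · exact ⟨m, h1, h2, Or.inl e2, Or.inl (by omega)⟩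
      · exact ⟨m, h1, h2, Or.inr (Or.inr ⟨i', e3⟩), Or.inl e4⟩
      · exact ⟨m, h1, h2, Or.inl e3, Or.inr (Or.inr ⟨i', e4⟩)⟩
    obtain ⟨t, ⟨rfl, rfl⟩ | ⟨rfl, rfl⟩⟩ := H
    · obtain ⟨m, h1, h2, e1, e2⟩ := fstE
      exact ⟨m + t * (n + 1), by omega, by omega, edgeI_shift ε t e1, edgeI_shift ε t e2⟩
    · by_cases hi : i.val + 1 < n
      · obtain ⟨m, h1, h2, i', e1, ⟨e2, e3, e4⟩ | ⟨e2, e3, e4⟩⟩ := outerI ε i hi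
        · refine ⟨m + t * (n + 1), by omega, by omega, edgeI_shift ε t (Or.inl e3),
            edgeI_shift ε t (Or.inr (Or.inr ⟨i', e4⟩))⟩
        · refine ⟨m + t * (n + 1), by omega, by omega,
            edgeI_shift ε t (Or.inr (Or.inr ⟨i', e3⟩)), edgeI_shift ε t (Or.inl e4)⟩
      · obtain ⟨m, h1, h2, e1, e2⟩ := fstE
        have hi' : (i.val : ℤ) + 1 = n := by omega
        refine ⟨m + (t + 1) * (n + 1), ?_, ?_, ?_, ?_⟩
        · rw [add_mul]; omega
        · rw [add_mul]; omega
        · convert edgeI_shift ε (t + 1) e1 using 1; rw [← hi']; ring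
        · convert edgeI_shift ε (t + 1) e2 using 1; rw [← hi']; ring

theorem ind_bd {ι : Type} {h : ℤ} {A : ι → ℤ → ℤ → Prop} (T : TriC h A) (i : ι) (p : ℤ) :
    indT A i p (p + 1) = 0 := by
  have : ¬ A i p (p + 1) := fun H => by have := T.lo H; omega
  simp [indT, this]

theorem ind_arc {ι : Type} [DecidableEq ι] {h : ℤ} {A : ι → ℤ → ℤ → Prop} (T : TriC h A)
    {i j : ι} {p q : ℤ} (H : A j p q) : indT A i p q = if i = j then 1 else 0 := by
  by_cases c : i = j
  · subst c; simp [indT, H]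
  · have : ¬ A i p q := fun H' => c (T.disj H' H)
    simp [indT, this, c]

/-- the matrix of the initial triangulation -/
def bI (ε : ℕ → Prop) [DecidablePred ε] (n : ℕ) (i j : Fin n) : ℤ :=
  (if i.val + 1 = j.val then (if ε i.val then 1 else -1) * (if j.val + 1 = n then 2 else 1) else 0)
   + (if j.val + 1 = i.val then (if ε j.val then -1 else 1) else 0)

theorem realI : RealT ((n : ℤ) + 1) (AI ε n) (bI ε n) := by
  have T := triI ε (n := n)
  intro i j p m q m' Q
  have key : ∃ p m q m', QuadT (n + 1) (AI ε n) j p m q m' ∧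
      XT (n + 1) (indT (AI ε n) i) p m q m' = bI ε n i j := by
    obtain ⟨m, m', Q⟩ := T.quad (AI.fst ε j)
    refine ⟨_, _, _, _, Q, ?_⟩
    obtain ⟨g0, h1, h2, h3, h4, e1, e2, e3, e4⟩ := Q
    have inn : indT (AI ε n) i (lI ε j) m - indT (AI ε n) i m (lI ε j + (j.val + 2)) =
        if i.val + 1 = j.val then (if ε i.val then 1 else -1) else 0 := by
      obtain ⟨u, u1, u2, U⟩ := innerI ε j
      have hu : EdgeT (n + 1) (AI ε n) (lI ε j) u ∧
          EdgeT (n + 1) (AI ε n) u (lI ε j + (j.val + 2)) := by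
        rcases U with ⟨e1, e2⟩ | ⟨i', e1, e2, e3, e4⟩ | ⟨i', e1, e2, e3, e4⟩
        · exact ⟨Or.inl e2, Or.inl (by omega)⟩
        · exact ⟨Or.inr (Or.inr ⟨i', e3⟩), Or.inl e4⟩
        · exact ⟨Or.inl e3, Or.inr (Or.inr ⟨i', e4⟩)⟩
      have hm : u = m := T.uniq (by have := j.2; omega) hu.1 hu.2 e1 e2 u1 u2 h1 h2
      subst hm
      rcases U with ⟨f1, f2⟩ | ⟨i', f1, f2, f3, f4⟩ | ⟨i', f1, f2, f3, f4⟩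
      · have : lI ε j + (j.val + 2) = u + 1 := by omega
        rw [this, f2, ind_bd T, ind_bd T, if_neg (by omega)]
        rfl
      · rw [f4, ind_bd T, ind_arc T f3]
        by_cases c : i = i'
        · subst c; simp [f1, f2]
        · have : i.val ≠ i'.val := fun H => c (Fin.ext H)
          rw [if_neg c, if_neg (by omega)]; rfl
      · rw [f3] at f4 ⊢
        rw [ind_bd T, ind_arc T f4]
        by_cases c : i = i'
        · subst c; simp [f1, f2]
        · have : i.val ≠ i'.val := fun H => c (Fin.ext H)
          rw [if_neg c, if_neg (by omega)]; rfl
    have hX : XT (n + 1) (indT (AI ε n) i) (lI ε j) m (lI ε j + (j.val + 2)) m' =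
      (if i.val + 1 = j.val then (if ε i.val then 1 else -1) else 0) +
        (indT (AI ε n) i (lI ε j + (j.val + 2)) m' -
          indT (AI ε n) i m' (lI ε j + 2 * (n + 1))) := by
      rw [← inn]; unfold XT; ring
    rw [hX]
    by_cases hj : j.val + 1 < n
    · obtain ⟨u, u1, u2, i', f1, U⟩ := outerI ε j hj
      have hu : EdgeT (n + 1) (AI ε n) (lI ε j + (j.val + 2)) u ∧
          EdgeT (n + 1) (AI ε n) u (lI ε j + 2 * (n + 1)) := by
        rcases U with ⟨f2, f3, f4⟩ | ⟨f2, f3, f4⟩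
        · exact ⟨Or.inl f3, Or.inr (Or.inr ⟨i', f4⟩)⟩
        · exact ⟨Or.inr (Or.inr ⟨i', f3⟩), Or.inl f4⟩
      have hm : u = m' := T.uniq (by omega) hu.1 hu.2 e3 e4 u1 u2 h3 h4
      subst hm
      unfold bI
      rw [if_neg (by omega : ¬ j.val + 1 = n), mul_one]
      congr 1
      rcases U with ⟨f2, f3, f4⟩ | ⟨f2, f3, f4⟩
      · rw [f3] at f4 ⊢
        rw [ind_bd T, ind_arc T f4]
        by_cases c : i = i'
        · subst c; simp [f1, f2]
        · have : i.val ≠ i'.val := fun H => c (Fin.ext H)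
          rw [if_neg c, if_neg (by omega)]; rfl
      · rw [f4, ind_bd T, ind_arc T f3]
        by_cases c : i = i'
        · subst c; simp [f1, f2]
        · have : i.val ≠ i'.val := fun H => c (Fin.ext H)
          rw [if_neg c, if_neg (by omega)]; rfl
    · have hj' : (j.val : ℤ) + 1 = n := by have := j.2; omega
      have s1 : lI ε j + (j.val + 2) = lI ε j + 1 * ((n : ℤ) + 1) := by omega
      have s2 : lI ε j + 2 * ((n : ℤ) + 1) = lI ε j + (j.val + 2) + 1 * ((n : ℤ) + 1) := by omega
      have hm : m + 1 * ((n : ℤ) + 1) = m' := by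
        refine T.uniq (p := lI ε j + (j.val + 2)) (q := lI ε j + 2 * (n + 1)) (by omega) ?_ ?_ e3 e4
          (by omega) (by omega) h3 h4
        · rw [s1]; exact T.edge_shift 1 e1
        · rw [s2]; exact T.edge_shift 1 e2
      have F := T.indInv i
      rw [← hm, s2, F.shift_mul, s1, F.shift_mul, ← s1, inn]
      unfold bI
      rw [if_pos (by omega : j.val + 1 = n), if_neg (by have := i.2; omega : ¬ j.val + 1 = i.val)]
      split_ifs <;> rfl
  obtain ⟨p', n', q', n'', Q', X'⟩ := key
  rw [← X']
  exact T.X_indep (T.indInv i) Q' Q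

def IsReal {n : ℕ} (B : Matrix (Fin n) (Fin n) ℤ) : Prop :=
  ∃ A : Fin n → ℤ → ℤ → Prop, TriC ((n : ℤ) + 1) A ∧ RealT ((n : ℤ) + 1) A B

theorem RealT.reindex {ι κ : Type} {h : ℤ} {A : ι → ℤ → ℤ → Prop} {b : ι → ι → ℤ}
    (R : RealT h A b) (e : κ ≃ ι) : RealT h (fun i => A (e i)) (fun i j => b (e i) (e j)) := by
  have key : ∀ p q, EdgeT h (fun i => A (e i)) p q → EdgeT h A p q := by
    rintro p q (H | H | ⟨i, H⟩)
    · exact Or.inl H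
    · exact Or.inr (Or.inl H)
    · exact Or.inr (Or.inr ⟨e i, H⟩)
  rintro i j p m q m' ⟨h0, h1, h2, h3, h4, e1, e2, e3, e4⟩
  exact R (e i) (e j) p m q m' ⟨h0, h1, h2, h3, h4, key _ _ e1, key _ _ e2, key _ _ e3, key _ _ e4⟩

theorem isReal_cartan (B : Matrix (Fin n) (Fin n) ℤ) (d : Fin n → ℤ) (hd : ∀ i, 0 < d i)
    (hskew : ∀ i j, d i * B i j = - (d j * B j i)) (σ : Equiv.Perm (Fin n))
    (hσ : ∀ i j, cartanCounterpart B (σ i) (σ j) = cartanC n i j) : IsReal B := by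
  classical
  let ε : ℕ → Prop := fun i => ∃ (h1 : i < n) (h2 : i + 1 < n), 0 < B (σ ⟨i, h1⟩) (σ ⟨i + 1, h2⟩)
  refine ⟨_, (triI ε).reindex σ.symm, ?_⟩
  have R := (realI ε (n := n)).reindex σ.symm
  suffices hB : ∀ i j, B i j = bI ε n (σ.symm i) (σ.symm j) from
    fun i j p m q m' Q => (R i j p m q m' Q).trans (hB i j).symm
  intro i j
  obtain ⟨i, rfl⟩ := σ.surjective i
  obtain ⟨j, rfl⟩ := σ.surjective j
  simp only [Equiv.symm_apply_apply]
  have sk := hskew (σ i) (σ j)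
  have d1 := hd (σ i)
  have d2 := hd (σ j)
  have C := hσ i j
  unfold cartanCounterpart cartanC at C
  unfold bI
  by_cases hij : i = j
  · subst hij
    have : B (σ i) (σ i) = 0 := by nlinarith
    simp [this]
  have hv : i.val ≠ j.val := fun H => hij (Fin.ext H)
  rw [if_neg (fun H => hij (σ.injective H)), if_neg hij] at C
  by_cases c1 : i.val + 1 = j.val
  · have hε : ε i.val ↔ 0 < B (σ i) (σ j) := by
      have hj : (⟨i.val + 1, by omega⟩ : Fin n) = j := Fin.ext c1
      constructor
      · rintro ⟨h1, h2, h3⟩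
        rw [← hj]; exact h3
      · intro H
        refine ⟨i.2, by omega, ?_⟩
        rw [← hj] at H; exact H
    rw [if_pos c1, if_neg (by omega : ¬ j.val + 1 = i.val), add_zero]
    by_cases c2 : j.val + 1 = n
    · rw [if_pos ⟨by omega, c2⟩] at C
      rw [if_pos c2]
      by_cases c : ε i.val
      · rw [if_pos c]; rw [hε] at c
        rw [abs_of_pos c] at C; omega
      · rw [if_neg c]; rw [hε] at c
        rw [abs_of_nonpos (by omega)] at C; omega
    · rw [if_neg (fun H => c2 H.2), if_pos (Or.inl c1)] at C
      rw [if_neg c2]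
      by_cases c : ε i.val
      · rw [if_pos c]; rw [hε] at c
        rw [abs_of_pos c] at C; omega
      · rw [if_neg c]; rw [hε] at c
        rw [abs_of_nonpos (by omega)] at C; omega
  by_cases c2 : j.val + 1 = i.val
  · have hε : ε j.val ↔ 0 < B (σ j) (σ i) := by
      have hj : (⟨j.val + 1, by omega⟩ : Fin n) = i := Fin.ext c2
      constructor
      · rintro ⟨h1, h2, h3⟩
        rw [← hj]; exact h3
      · intro H
        refine ⟨j.2, by omega, ?_⟩
        rw [← hj] at H; exact H
    rw [if_neg c1, if_pos c2, zero_add]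
    rw [if_neg (by have := i.2; omega), if_pos (Or.inr c2)] at C
    by_cases c : ε j.val
    · rw [if_pos c]; rw [hε] at c
      have : B (σ i) (σ j) < 0 := by nlinarith [mul_pos d2 c]
      rw [abs_of_neg this] at C; omega
    · rw [if_neg c]; rw [hε] at c
      have : 0 ≤ B (σ i) (σ j) := by
        have := mul_nonneg d2.le (by omega : 0 ≤ - B (σ j) (σ i))
        by_contra hc
        have := mul_pos d1 (by omega : 0 < - B (σ i) (σ j))
        nlinarith
      rw [abs_of_nonneg this] at C; omega
  · rw [if_neg (by omega), if_neg (by omega)] at C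
    rw [if_neg c1, if_neg c2]
    have : |B (σ i) (σ j)| = 0 := by omega
    simpa using this

theorem IsReal.mut {B : Matrix (Fin n) (Fin n) ℤ} (R : IsReal B) (k : Fin n) :
    IsReal (mutMat k B) := by
  obtain ⟨A, T, R⟩ := R
  refine ⟨_, T.flip k, ?_⟩
  intro i j p m q m' Q
  unfold mutMat
  by_cases hi : i = k
  · subst hi
    rw [if_pos (Or.inl rfl)]
    exact T.mut_row (R i j) Q
  · have he : indT (flipT ((n : ℤ) + 1) A k) i = indT A i := by
      funext p q; by_cases H : A i p q <;> simp [indT, flipT_ne hi, H]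
    rw [he]
    by_cases hj : j = k
    · subst hj
      rw [if_pos (Or.inr rfl)]
      exact T.mut_k (T.indInv i) (R i j) Q
    · rw [if_neg (by tauto)]
      exact T.mut_col (T.indInv i) (R i k) (T.ptol_ind hi) (R i j) (R k j) hj Q

theorem mutMat_invol (k : Fin n) (B : Matrix (Fin n) (Fin n) ℤ) :
    mutMat k (mutMat k B) = B := by
  funext i j
  unfold mutMat
  by_cases hi : i = k <;> by_cases hj : j = k <;> simp [hi, hj]

theorem mutMat_skew (k : Fin n) (B : Matrix (Fin n) (Fin n) ℤ) (d : Fin n → ℤ) (hd : ∀ i, 0 < d i)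
    (hskew : ∀ i j, d i * B i j = - (d j * B j i)) :
    ∀ i j, d i * mutMat k B i j = - (d j * mutMat k B j i) := by
  intro i j
  unfold mutMat
  have h0 := hskew i j
  by_cases hi : i = k <;> by_cases hj : j = k <;> simp only [hi, hj, true_or, or_true, if_true,
      or_self, if_false]
  · subst hi; subst hj; linarith
  · subst hi; linarith
  · subst hj; linarith
  · have h1 := hskew i k
    have h2 := hskew k j
    have h3 := hd i
    have h4 := hd j
    have h5 := hd k
    have s1 : (B i k).sign = - (B k i).sign := by
      rcases lt_trichotomy (B i k) 0 with c | c | c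
      · have : 0 < B k i := by
          by_contra hh
          nlinarith [mul_pos h3 (neg_pos.2 c), mul_nonneg h5.le (neg_nonneg.2 (not_lt.1 hh))]
        rw [Int.sign_eq_neg_one_of_neg c, Int.sign_eq_one_of_pos this]
      · have : B k i = 0 := by rw [c] at h1; nlinarith
        rw [c, this]; rfl
      · have : B k i < 0 := by
          by_contra hh
          nlinarith [mul_pos h3 c, mul_nonneg h5.le (not_lt.1 hh)]
        rw [Int.sign_eq_neg_one_of_neg this, Int.sign_eq_one_of_pos c]; rfl
    have s2 : (B k j).sign = - (B j k).sign := by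
      rcases lt_trichotomy (B k j) 0 with c | c | c
      · have : 0 < B j k := by
          by_contra hh
          nlinarith [mul_pos h5 (neg_pos.2 c), mul_nonneg h4.le (neg_nonneg.2 (not_lt.1 hh))]
        rw [Int.sign_eq_neg_one_of_neg c, Int.sign_eq_one_of_pos this]
      · have : B j k = 0 := by rw [c] at h2; nlinarith
        rw [c, this]; rfl
      · have : B j k < 0 := by
          by_contra hh
          nlinarith [mul_pos h5 c, mul_nonneg h4.le (not_lt.1 hh)]
        rw [Int.sign_eq_neg_one_of_neg this, Int.sign_eq_one_of_pos c]; rfl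
    have e : d i * (B i k * B k j) = d j * (B j k * B k i) := by
      calc d i * (B i k * B k j) = (d i * B i k) * B k j := by ring
        _ = - (d k * B k j) * B k i := by rw [h1]; ring
        _ = _ := by rw [h2]; ring
    have e' : d i * max (B i k * B k j) 0 = d j * max (B j k * B k i) 0 := by
      rw [mul_max_of_nonneg _ _ h3.le, mul_max_of_nonneg _ _ h4.le, e]; simp
    rcases lt_trichotomy (B j k * B k i) 0 with c | c | c
    · rw [max_eq_right c.le] at e' ⊢
      rw [mul_zero] at e'
      have : max (B i k * B k j) 0 = 0 := by
        rcases mul_eq_zero.1 e' with h | h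
        · omega
        · exact h
      rw [this]; linarith
    · rw [c] at e' ⊢
      rw [max_self, mul_zero] at e'
      have : max (B i k * B k j) 0 = 0 := by
        rcases mul_eq_zero.1 e' with h | h
        · omega
        · exact h
      rw [this]; simpa using h0
    · have hs : (B j k).sign = (B k i).sign := by
        rcases pos_and_pos_or_neg_and_neg_of_mul_pos c with ⟨a, b⟩ | ⟨a, b⟩
        · rw [Int.sign_eq_one_of_pos a, Int.sign_eq_one_of_pos b]
        · rw [Int.sign_eq_neg_one_of_neg a, Int.sign_eq_neg_one_of_neg b]
      rw [s1, hs, mul_add, mul_add, h0]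
      linear_combination (-(B k i).sign) * e'

theorem isReal_typeC (B : Matrix (Fin n) (Fin n) ℤ) (htype : MatrixOfTypeC B)
    (d : Fin n → ℤ) (hd : ∀ i, 0 < d i)
    (hskew : ∀ i j, d i * B i j = - (d j * B j i)) : IsReal B := by
  obtain ⟨B', hB, σ, hσ⟩ := htype
  induction hB using Relation.ReflTransGen.head_induction_on with
  | refl => exact isReal_cartan B' d hd hskew σ hσ
  | head h1 h2 ih =>
    obtain ⟨k, rfl⟩ := h1
    have := (ih (mutMat_skew k _ d hd hskew)).mut k
    rwa [mutMat_invol] at this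

end InitSec
end

noncomputable section

section CohSec

variable {n : ℕ}

def topP (b : Matrix (Fin n ⊕ Fin n) (Fin n) ℤ) : Matrix (Fin n) (Fin n) ℤ :=
  fun i j => b (Sum.inl i) j

def botP (b : Matrix (Fin n ⊕ Fin n) (Fin n) ℤ) : Matrix (Fin n) (Fin n) ℤ :=
  fun i j => b (Sum.inr i) j

theorem topP_mut (k : Fin n) (b : Matrix (Fin n ⊕ Fin n) (Fin n) ℤ) :
    topP (mutMatExt k b) = mutMat k (topP b) := by
  funext i j
  simp [topP, mutMatExt, mutMat]

theorem botP_mut (k : Fin n) (b : Matrix (Fin n ⊕ Fin n) (Fin n) ℤ) (i j : Fin n) :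
    botP (mutMatExt k b) i j = if j = k then - botP b i j
      else botP b i j + (botP b i k).sign * max (botP b i k * topP b k j) 0 := by
  simp [topP, botP, mutMatExt]

/-- sign-coherence of c-vectors -/
def Coh (b : Matrix (Fin n ⊕ Fin n) (Fin n) ℤ) : Prop :=
  ∀ k, (∀ i, 0 ≤ botP b i k) ∨ (∀ i, botP b i k ≤ 0)

/-- extended version of a realization -/
def ExtReal (p q w : Fin n → ℤ) (b : Matrix (Fin n ⊕ Fin n) (Fin n) ℤ) : Prop :=
  ∃ A : Fin n → ℤ → ℤ → Prop, TriC ((n : ℤ) + 1) A ∧ RealT ((n : ℤ) + 1) A (topP b) ∧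
    ∀ i j a m c m', QuadT ((n : ℤ) + 1) A j a m c m' →
      XT ((n : ℤ) + 1) (lamT ((n : ℤ) + 1) (p i) (q i)) a m c m' = w i * botP b i j

theorem real_flip {A : Fin n → ℤ → ℤ → Prop} {B : Matrix (Fin n) (Fin n) ℤ}
    (T : TriC ((n : ℤ) + 1) A) (R : RealT ((n : ℤ) + 1) A B) (k : Fin n) :
    RealT ((n : ℤ) + 1) (flipT ((n : ℤ) + 1) A k) (mutMat k B) := by
  intro i j p m q m' Q
  unfold mutMat
  by_cases hi : i = k
  · subst hi
    rw [if_pos (Or.inl rfl)]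
    exact T.mut_row (R i j) Q
  · have he : indT (flipT ((n : ℤ) + 1) A k) i = indT A i := by
      funext p q; by_cases H : A i p q <;> simp [indT, flipT_ne hi, H]
    rw [he]
    by_cases hj : j = k
    · subst hj
      rw [if_pos (Or.inr rfl)]
      exact T.mut_k (T.indInv i) (R i j) Q
    · rw [if_neg (by tauto)]
      exact T.mut_col (T.indInv i) (R i k) (T.ptol_ind hi) (R i j) (R k j) hj Q

theorem ExtReal.mut {A0 : Fin n → ℤ → ℤ → Prop} (T0 : TriC ((n : ℤ) + 1) A0) {p q w : Fin n → ℤ}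
    (hpq : ∀ i, A0 i (p i) (q i)) (hw : ∀ i, 0 < w i) {b : Matrix (Fin n ⊕ Fin n) (Fin n) ℤ}
    (E : ExtReal p q w b) (k : Fin n) : ExtReal p q w (mutMatExt k b) := by
  obtain ⟨A, T, R, L⟩ := E
  refine ⟨_, T.flip k, ?_, ?_⟩
  · rw [topP_mut]; exact real_flip T R k
  · intro i j a m c m' Q
    have F := lamT_inv ((n : ℤ) + 1) (p i) (q i)
    rw [botP_mut]
    by_cases hj : j = k
    · subst hj
      rw [if_pos rfl, T.mut_k F (L i j) Q]; ring
    · rw [if_neg hj, T.mut_col F (L i k) (T0.lam_ptol (hpq i) k) (L i j) (R k j) hj Q,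
        Int.sign_mul, Int.sign_eq_one_of_pos (hw i), one_mul, mul_assoc,
        mul_add]
      have : max (w i * (botP b i k * topP b k j)) 0 = w i * max (botP b i k * topP b k j) 0 := by
        rw [mul_max_of_nonneg _ _ (hw i).le, mul_zero]
      rw [this]; ring

theorem ExtReal.coh {A0 : Fin n → ℤ → ℤ → Prop} (T0 : TriC ((n : ℤ) + 1) A0) {p q w : Fin n → ℤ}
    (hpq : ∀ i, A0 i (p i) (q i)) (hw : ∀ i, 0 < w i) {b : Matrix (Fin n ⊕ Fin n) (Fin n) ℤ}
    (E : ExtReal p q w b) : Coh b := by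
  obtain ⟨A, T, R, L⟩ := E
  intro k
  by_contra hc
  push Not at hc
  obtain ⟨⟨i, hi⟩, ⟨j, hj⟩⟩ := hc
  obtain ⟨a, c, H⟩ := T.ne k
  obtain ⟨m, m', Q⟩ := T.quad H
  obtain ⟨g0, h1, h2, h3, h4, -⟩ := id Q
  refine T0.lam_coh (hpq j) (hpq i) h1 h2 h3 h4 ⟨?_, ?_⟩
  · rw [L j k _ _ _ _ Q]; exact mul_pos (hw j) hj
  · rw [L i k _ _ _ _ Q]; exact mul_neg_of_pos_of_neg (hw i) hi

theorem extMat_coh (B : Matrix (Fin n) (Fin n) ℤ) (hB : IsReal B)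
    (b : Matrix (Fin n ⊕ Fin n) (Fin n) ℤ) (hb : IsExtMat B b) : Coh b := by
  obtain ⟨A0, T0, R0⟩ := hB
  choose p q hpq using T0.ne
  choose w hw hL using fun i => T0.lam_init (hpq i)
  have key : ExtReal p q w b := by
    induction hb with
    | refl =>
      refine ⟨A0, T0, R0, ?_⟩
      intro i j a m c m' Q
      by_cases hij : j = i
      · subst hij
        rw [(hL j j _ _ _ _ Q).1 rfl]; simp [botP, extMat]
      · rw [(hL i j _ _ _ _ Q).2 hij]; simp [botP, extMat, Ne.symm hij]
    | tail _ h ih =>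
      obtain ⟨k, rfl⟩ := h
      exact ih.mut T0 hpq hw k
  exact key.coh T0 hpq hw

end CohSec

end

open MvPolynomial Matrix
noncomputable section

section GSec

variable {n : ℕ}

theorem wtOf_add (B : Matrix (Fin n) (Fin n) ℤ) (a b : (Fin n ⊕ Fin n) →₀ ℕ) :
    wtOf B (a + b) = wtOf B a + wtOf B b := by
  funext i
  simp only [wtOf, Finsupp.add_apply, Pi.add_apply, Nat.cast_add, add_mul, Finset.sum_add_distrib]
  ring

theorem homog_mul {B : Matrix (Fin n) (Fin n) ℤ} {g g' : Fin n → ℤ}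
    {p p' : MvPolynomial (Fin n ⊕ Fin n) ℚ}
    (h : IsHomogOfWt B g p) (h' : IsHomogOfWt B g' p') : IsHomogOfWt B (g + g') (p * p') := by
  classical
  intro m hm
  have := MvPolynomial.support_mul p p' hm
  obtain ⟨a, ha, b, hb, rfl⟩ := Finset.mem_add.1 this
  rw [wtOf_add, h a ha, h' b hb]

theorem homog_add {B : Matrix (Fin n) (Fin n) ℤ} {g : Fin n → ℤ}
    {p p' : MvPolynomial (Fin n ⊕ Fin n) ℚ}
    (h : IsHomogOfWt B g p) (h' : IsHomogOfWt B g p') : IsHomogOfWt B g (p + p') := by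
  classical
  intro m hm
  rcases Finset.mem_union.1 (MvPolynomial.support_add hm) with H | H
  · exact h m H
  · exact h' m H

theorem homog_one (B : Matrix (Fin n) (Fin n) ℤ) : IsHomogOfWt B 0 1 := by
  classical
  intro m hm
  have : m = 0 := by
    by_contra hc
    rw [MvPolynomial.mem_support_iff, MvPolynomial.coeff_one, if_neg (Ne.symm hc)] at hm
    exact hm rfl
  subst this
  funext i
  simp [wtOf]

theorem homog_X (B : Matrix (Fin n) (Fin n) ℤ) (v : Fin n ⊕ Fin n) :
    IsHomogOfWt B (wtOf B (Finsupp.single v 1)) (X v) := by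
  classical
  intro m hm
  rw [MvPolynomial.support_X, Finset.mem_singleton] at hm
  rw [hm]

abbrev toF (n : ℕ) : MvPolynomial (Fin n ⊕ Fin n) ℚ →+* PField n :=
  algebraMap (MvPolynomial (Fin n ⊕ Fin n) ℚ) (PField n)

theorem toF_inj (n : ℕ) : Function.Injective (toF n) := IsFractionRing.injective _ _

/-- positivity at the all-ones point -/
def PosOne (p : MvPolynomial (Fin n ⊕ Fin n) ℚ) : Prop :=
  0 < MvPolynomial.eval (fun _ => (1 : ℚ)) p

theorem PosOne.ne {p : MvPolynomial (Fin n ⊕ Fin n) ℚ} (h : PosOne p) : p ≠ 0 := by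
  rintro rfl
  simp [PosOne] at h

theorem PosOne.mul {p q : MvPolynomial (Fin n ⊕ Fin n) ℚ} (h : PosOne p) (h' : PosOne q) :
    PosOne (p * q) := by
  unfold PosOne at *
  rw [map_mul]; exact mul_pos h h'

theorem PosOne.add {p q : MvPolynomial (Fin n ⊕ Fin n) ℚ} (h : PosOne p) (h' : PosOne q) :
    PosOne (p + q) := by
  unfold PosOne at *
  rw [map_add]; exact add_pos h h'

theorem posOne_one : PosOne (1 : MvPolynomial (Fin n ⊕ Fin n) ℚ) := by
  simp [PosOne]

/-- positive homogeneous elements of the field -/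
def HomP (B : Matrix (Fin n) (Fin n) ℤ) (g : Fin n → ℤ) (y : PField n) : Prop :=
  ∃ p q : MvPolynomial (Fin n ⊕ Fin n) ℚ, ∃ gp gq : Fin n → ℤ,
    IsHomogOfWt B gp p ∧ IsHomogOfWt B gq q ∧ PosOne p ∧ PosOne q ∧
      y = toF n p / toF n q ∧ g = gp - gq

theorem HomP.ne {B : Matrix (Fin n) (Fin n) ℤ} {g : Fin n → ℤ} {y : PField n} (h : HomP B g y) :
    y ≠ 0 := by
  obtain ⟨p, q, gp, gq, h1, h2, h3, h4, rfl, rfl⟩ := h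
  have := (map_ne_zero_iff _ (toF_inj n)).2 h3.ne
  have := (map_ne_zero_iff _ (toF_inj n)).2 h4.ne
  positivity

theorem HomP.mul {B : Matrix (Fin n) (Fin n) ℤ} {g g' : Fin n → ℤ} {y y' : PField n}
    (h : HomP B g y) (h' : HomP B g' y') : HomP B (g + g') (y * y') := by
  obtain ⟨p, q, gp, gq, h1, h2, h3, h4, rfl, rfl⟩ := h
  obtain ⟨p', q', gp', gq', h1', h2', h3', h4', rfl, rfl⟩ := h'
  refine ⟨p * p', q * q', _, _, homog_mul h1 h1', homog_mul h2 h2', h3.mul h3', h4.mul h4', ?_, ?_⟩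
  · rw [map_mul, map_mul, div_mul_div_comm]
  · abel

theorem HomP.inv {B : Matrix (Fin n) (Fin n) ℤ} {g : Fin n → ℤ} {y : PField n}
    (h : HomP B g y) : HomP B (-g) y⁻¹ := by
  obtain ⟨p, q, gp, gq, h1, h2, h3, h4, rfl, rfl⟩ := h
  refine ⟨q, p, _, _, h2, h1, h4, h3, ?_, ?_⟩
  · rw [inv_div]
  · abel

theorem HomP.div {B : Matrix (Fin n) (Fin n) ℤ} {g g' : Fin n → ℤ} {y y' : PField n}
    (h : HomP B g y) (h' : HomP B g' y') : HomP B (g - g') (y / y') := by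
  rw [div_eq_mul_inv, sub_eq_add_neg]; exact h.mul h'.inv

theorem HomP.add {B : Matrix (Fin n) (Fin n) ℤ} {g : Fin n → ℤ} {y y' : PField n}
    (h : HomP B g y) (h' : HomP B g y') : HomP B g (y + y') := by
  obtain ⟨p, q, gp, gq, h1, h2, h3, h4, rfl, rfl⟩ := h
  obtain ⟨p', q', gp', gq', h1', h2', h3', h4', rfl, e⟩ := h'
  have e2 : gq + gp' = gp + gq' := by
    have : gp' = gp - gq + gq' := by rw [e]; abel
    rw [this]; abel
  have n1 := (map_ne_zero_iff _ (toF_inj n)).2 h4.ne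
  have n2 := (map_ne_zero_iff _ (toF_inj n)).2 h4'.ne
  refine ⟨p * q' + q * p', q * q', _, _, homog_add (homog_mul h1 h2') (e2 ▸ homog_mul h2 h1'),
    homog_mul h2 h2', (h3.mul h4').add (h4.mul h3'), h4.mul h4', ?_, ?_⟩
  · rw [map_mul, map_add, map_mul, map_mul, div_add_div _ _ n1 n2]
  · abel

theorem homP_one (B : Matrix (Fin n) (Fin n) ℤ) : HomP B 0 (1 : PField n) :=
  ⟨1, 1, 0, 0, homog_one B, homog_one B, posOne_one, posOne_one, by simp, by simp⟩

theorem HomP.pow {B : Matrix (Fin n) (Fin n) ℤ} {g : Fin n → ℤ} {y : PField n}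
    (h : HomP B g y) (k : ℕ) : HomP B ((k : ℤ) • g) (y ^ k) := by
  induction k with
  | zero => simpa using homP_one B
  | succ k ih =>
    rw [pow_succ]
    convert ih.mul h using 1
    push_cast
    rw [add_smul, one_smul]

theorem HomP.prod {B : Matrix (Fin n) (Fin n) ℤ} {ι : Type} (s : Finset ι) {g : ι → Fin n → ℤ}
    {y : ι → PField n} (h : ∀ i, HomP B (g i) (y i)) :
    HomP B (∑ i ∈ s, g i) (∏ i ∈ s, y i) := by
  classical
  induction s using Finset.induction_on with
  | empty => simpa using homP_one B
  | insert a s ha ih =>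
    rw [Finset.sum_insert ha, Finset.prod_insert ha]
    exact (h a).mul ih

theorem homP_inl (B : Matrix (Fin n) (Fin n) ℤ) (j : Fin n) :
    HomP B (fun i => if i = j then 1 else 0) (xVar n (Sum.inl j)) := by
  refine ⟨X (Sum.inl j), 1, _, _, homog_X B _, homog_one B, by simp [PosOne], posOne_one,
    by simp [xVar], ?_⟩
  funext i
  simp [wtOf, Finsupp.single_apply, eq_comm]

theorem homP_inr (B : Matrix (Fin n) (Fin n) ℤ) (j : Fin n) :
    HomP B (fun i => - B i j) (xVar n (Sum.inr j)) := by
  refine ⟨X (Sum.inr j), 1, _, _, homog_X B _, homog_one B, by simp [PosOne], posOne_one,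
    by simp [xVar], ?_⟩
  funext i
  simp [wtOf, Finsupp.single_apply]

theorem homog_uniq {B : Matrix (Fin n) (Fin n) ℤ} {g g' : Fin n → ℤ}
    {p : MvPolynomial (Fin n ⊕ Fin n) ℚ} (hp : p ≠ 0)
    (h : IsHomogOfWt B g p) (h' : IsHomogOfWt B g' p) : g = g' := by
  obtain ⟨m, hm⟩ := Finset.nonempty_of_ne_empty (fun H => hp (MvPolynomial.support_eq_empty.1 H))
  rw [← h m hm, h' m hm]

theorem HomP.uniq {B : Matrix (Fin n) (Fin n) ℤ} {g g' : Fin n → ℤ} {y : PField n}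
    (h : HomP B g y) (h' : HasGVector B g' y) : g' = g := by
  obtain ⟨p, q, gp, gq, h1, h2, h3, h4, e1, rfl⟩ := h
  obtain ⟨p', q', gp', gq', h1', h2', h4', e2, rfl⟩ := h'
  have n1 := (map_ne_zero_iff _ (toF_inj n)).2 h4.ne
  have n2 := (map_ne_zero_iff _ (toF_inj n)).2 h4'
  have E : toF n p / toF n q = toF n p' / toF n q' := by rw [← e1, e2]
  rw [div_eq_div_iff n1 n2, ← map_mul, ← map_mul] at E
  have E' := toF_inj n E
  have := homog_uniq (mul_ne_zero h3.ne h4') (homog_mul h1 h2') (E' ▸ homog_mul h1' h2)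
  funext i
  have := congrFun this i
  simp only [Pi.add_apply, Pi.sub_apply] at *
  omega

end GSec

section MatSec

variable {n : ℕ}

theorem scal_top (ε x y : ℤ) (hε : ε = 1 ∨ ε = -1) :
    max (-ε * x) 0 * y + x * max (ε * y) 0 = x.sign * max (x * y) 0 := by
  rcases lt_trichotomy x 0 with hx | hx | hx <;> rcases lt_trichotomy y 0 with hy | hy | hy
  all_goals
    first
    | (subst hx; simp)
    | (subst hy; simp)
    | skip
  · have := mul_pos_of_neg_of_neg hx hy
    rw [Int.sign_eq_neg_one_of_neg hx, max_eq_left this.le]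
    rcases hε with rfl | rfl
    · rw [max_eq_left (by omega), max_eq_right (by omega)]; ring
    · rw [max_eq_right (by omega), max_eq_left (by omega)]; ring
  · have := mul_neg_of_neg_of_pos hx hy
    rw [max_eq_right this.le]
    rcases hε with rfl | rfl
    · rw [max_eq_left (by omega), max_eq_left (by omega)]; ring
    · rw [max_eq_right (by omega), max_eq_right (by omega)]; ring
  · have := mul_neg_of_pos_of_neg hx hy
    rw [max_eq_right this.le]
    rcases hε with rfl | rfl
    · rw [max_eq_right (by omega), max_eq_right (by omega)]; ring
    · rw [max_eq_left (by omega), max_eq_left (by omega)]; ring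
  · have := mul_pos hx hy
    rw [Int.sign_eq_one_of_pos hx, max_eq_left this.le]
    rcases hε with rfl | rfl
    · rw [max_eq_right (by omega), max_eq_left (by omega)]; ring
    · rw [max_eq_left (by omega), max_eq_right (by omega)]; ring

theorem scal_bot (ε x y : ℤ) (hε : ε = 1 ∨ ε = -1) (hx : 0 ≤ ε * x) :
    x * max (ε * y) 0 = x.sign * max (x * y) 0 := by
  have : max (-ε * x) 0 = 0 := max_eq_right (by linarith)
  rw [← scal_top ε x y hε, this]; ring

def matE (k : Fin n) (a : Fin n → ℤ) : Matrix (Fin n) (Fin n) ℤ :=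
  fun i j => (if i = j then 1 else 0) + (if j = k then a i else 0)

def matF (k : Fin n) (c : Fin n → ℤ) : Matrix (Fin n) (Fin n) ℤ :=
  fun i j => (if i = j then 1 else 0) + (if i = k then c j else 0)

theorem mul_matE (G : Matrix (Fin n) (Fin n) ℤ) (k : Fin n) (a : Fin n → ℤ) (i j : Fin n) :
    (G * matE k a) i j = G i j + if j = k then ∑ l, G i l * a l else 0 := by
  rw [Matrix.mul_apply]
  by_cases h : j = k <;> simp [matE, h, mul_add, Finset.sum_add_distrib]

theorem matE_mul (M : Matrix (Fin n) (Fin n) ℤ) (k : Fin n) (a : Fin n → ℤ) (i j : Fin n) :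
    (matE k a * M) i j = M i j + a i * M k j := by
  rw [Matrix.mul_apply]
  simp [matE, add_mul, Finset.sum_add_distrib]

theorem mul_matF (C : Matrix (Fin n) (Fin n) ℤ) (k : Fin n) (c : Fin n → ℤ) (i j : Fin n) :
    (C * matF k c) i j = C i j + C i k * c j := by
  rw [Matrix.mul_apply]
  simp [matF, mul_add, Finset.sum_add_distrib]

theorem matE_sq (k : Fin n) (a : Fin n → ℤ) (ha : a k = -2) : matE k a * matE k a = 1 := by
  ext i j
  rw [matE_mul]
  simp only [matE, Matrix.one_apply]
  by_cases h : j = k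
  · subst h; simp [ha]
  · simp [h, Ne.symm h]

theorem matF_sq (k : Fin n) (c : Fin n → ℤ) (hc : c k = -2) : matF k c * matF k c = 1 := by
  ext i j
  rw [mul_matF]
  simp only [matF, Matrix.one_apply]
  by_cases h : i = k
  · subst h; simp [hc]
  · simp [h]

theorem matE_D (k : Fin n) (a c d : Fin n → ℤ) (h : ∀ j, d j * a j = d k * c j) :
    (matE k a)ᵀ * Matrix.diagonal d = Matrix.diagonal d * matF k c := by
  ext i j
  rw [Matrix.mul_diagonal, Matrix.diagonal_mul, Matrix.transpose_apply]
  simp only [matE, matF]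
  by_cases hi : i = k
  · subst hi
    by_cases hj : j = i
    · subst hj
      have := h j
      simp; linarith
    · have := h j
      simp [hj, Ne.symm hj]; linarith
  · by_cases hj : j = i
    · subst hj; simp [hi]
    · simp [hi, hj, Ne.symm hj]

end MatSec

section SeedSec

variable {n : ℕ}

/-- the inductive seed invariant -/
def SeedInv (B : Matrix (Fin n) (Fin n) ℤ) (d : Fin n → ℤ)
    (s : Matrix (Fin n ⊕ Fin n) (Fin n) ℤ × (Fin n → PField n)) : Prop :=
  ∃ G : Matrix (Fin n) (Fin n) ℤ, (∀ j, HomP B (fun i => G i j) (s.2 j)) ∧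
    G * topP s.1 = B * botP s.1 ∧
    Gᵀ * Matrix.diagonal d * botP s.1 = Matrix.diagonal d ∧
    ∀ i j, d i * topP s.1 i j = - (d j * topP s.1 j i)

theorem seedInv_init (B : Matrix (Fin n) (Fin n) ℤ) (d : Fin n → ℤ)
    (hskew : ∀ i j, d i * B i j = - (d j * B j i)) : SeedInv B d (initSeedP n B) := by
  have hb : botP (initSeedP n B).1 = 1 := by
    ext i j; simp [botP, initSeedP, extMat, Matrix.one_apply]
  have ht : topP (initSeedP n B).1 = B := by
    ext i j; simp [topP, initSeedP, extMat]
  refine ⟨1, ?_, ?_, ?_, ?_⟩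
  · intro j
    exact homP_inl B j
  · rw [hb, ht]; simp
  · rw [hb]; simp
  · rw [ht]; exact hskew

theorem toNat_max (x : ℤ) : ((x.toNat : ℕ) : ℤ) = max x 0 := by omega

theorem max_sub (x : ℤ) : max x 0 - max (-x) 0 = x := by omega

theorem SeedInv.mut {B : Matrix (Fin n) (Fin n) ℤ} {d : Fin n → ℤ} (hd : ∀ i, 0 < d i)
    {s : Matrix (Fin n ⊕ Fin n) (Fin n) ℤ × (Fin n → PField n)} (I : SeedInv B d s)
    (hc : Coh s.1) (k : Fin n) : SeedInv B d (mutSeedP k s) := by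
  obtain ⟨G, hG, h1, h2, h3⟩ := I
  obtain ⟨ε, hε, hcε⟩ : ∃ ε : ℤ, (ε = 1 ∨ ε = -1) ∧ ∀ i, 0 ≤ ε * botP s.1 i k := by
    rcases hc k with H | H
    · exact ⟨1, Or.inl rfl, fun i => by have := H i; omega⟩
    · exact ⟨-1, Or.inr rfl, fun i => by have := H i; omega⟩
  have hkk : topP s.1 k k = 0 := by
    have := h3 k k
    have := hd k
    nlinarith
  let a : Fin n → ℤ := fun i => max (-ε * topP s.1 i k) 0 - if i = k then 2 else 0
  let c : Fin n → ℤ := fun j => max (ε * topP s.1 k j) 0 - if j = k then 2 else 0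
  have ha : a k = -2 := by simp [a, hkk]
  have hck : c k = -2 := by simp [c, hkk]
  have hac : ∀ j, d j * a j = d k * c j := by
    intro j
    simp only [a, c, mul_sub]
    congr 1
    · rw [mul_max_of_nonneg _ _ (hd j).le, mul_max_of_nonneg _ _ (hd k).le]
      congr 1
      · linear_combination (-ε) * h3 j k
      · simp
    · by_cases h : j = k <;> simp [h]
  have hB : topP (mutSeedP k s).1 = matE k a * topP s.1 * matF k c := by
    ext i j
    change topP (mutMatExt k s.1) i j = _
    rw [topP_mut, mul_matF, matE_mul, matE_mul, hkk, mul_zero, add_zero]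
    simp only [mutMat, a, c]
    by_cases hi : i = k
    · subst hi
      simp [hkk]; ring
    · by_cases hj : j = k
      · subst hj; simp [hkk, hi]; ring
      · simp only [hi, hj, or_self, if_false, sub_zero]
        rw [← scal_top ε _ _ hε]; ring
  have hC : botP (mutSeedP k s).1 = botP s.1 * matF k c := by
    ext i j
    change botP (mutMatExt k s.1) i j = _
    rw [botP_mut, mul_matF]
    simp only [c]
    by_cases hj : j = k
    · subst hj; simp [hkk]; ring
    · simp only [hj, if_false, sub_zero]
      rw [← scal_bot ε _ _ hε (hcε i)]
  refine ⟨G * matE k a, ?_, ?_, ?_, ?_⟩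
  · intro j
    by_cases hj : j = k
    · subst hj
      have e0 : (mutSeedP j s).2 j = (((∏ i, s.2 i ^ (s.1 (Sum.inl i) j).toNat) *
            ∏ l, xVar n (Sum.inr l) ^ (s.1 (Sum.inr l) j).toNat +
          (∏ i, s.2 i ^ (-(s.1 (Sum.inl i) j)).toNat) *
            ∏ l, xVar n (Sum.inr l) ^ (-(s.1 (Sum.inr l) j)).toNat) / s.2 j) := by
        simp [mutSeedP]
      rw [e0]
      have P1 := (HomP.prod Finset.univ (fun i => (hG i).pow (s.1 (Sum.inl i) j).toNat)).mul
        (HomP.prod Finset.univ (fun l => (homP_inr B l).pow (s.1 (Sum.inr l) j).toNat))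
      have P2 := (HomP.prod Finset.univ (fun i => (hG i).pow (-(s.1 (Sum.inl i) j)).toNat)).mul
        (HomP.prod Finset.univ (fun l => (homP_inr B l).pow (-(s.1 (Sum.inr l) j)).toNat))
      let g : Fin n → ℤ := fun i => ∑ l, G i l * max (-ε * topP s.1 l j) 0
      have key : ∀ i, (∑ l, max (topP s.1 l j) 0 * G i l + ∑ l, max (botP s.1 l j) 0 * - B i l) =
          ∑ l, max (-topP s.1 l j) 0 * G i l + ∑ l, max (-botP s.1 l j) 0 * - B i l := by
        intro i
        have := congrFun (congrFun h1 i) j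
        rw [Matrix.mul_apply, Matrix.mul_apply] at this
        have t1 : ∑ l, max (topP s.1 l j) 0 * G i l - ∑ l, max (-topP s.1 l j) 0 * G i l =
            ∑ l, G i l * topP s.1 l j := by
          rw [← Finset.sum_sub_distrib]
          refine Finset.sum_congr rfl fun l _ => ?_
          rw [← sub_mul, max_sub, mul_comm]
        have t2 : ∑ l, max (botP s.1 l j) 0 * - B i l - ∑ l, max (-botP s.1 l j) 0 * - B i l =
            - ∑ l, B i l * botP s.1 l j := by
          rw [← Finset.sum_sub_distrib, ← Finset.sum_neg_distrib]
          refine Finset.sum_congr rfl fun l _ => ?_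
          rw [← sub_mul, max_sub]; ring
        linarith
      have key2 : ∀ i, g i =
          ∑ l, max (-topP s.1 l j) 0 * G i l + ∑ l, max (-botP s.1 l j) 0 * - B i l := by
        intro i
        rcases hε with rfl | rfl
        · have : ∑ l, max (-botP s.1 l j) 0 * - B i l = 0 :=
            Finset.sum_eq_zero fun l _ => by
              have := hcε l
              rw [max_eq_right (by omega), zero_mul]
          rw [this, add_zero]
          refine Finset.sum_congr rfl fun l _ => ?_
          rw [mul_comm]; simp
        · rw [← key]
          have : ∑ l, max (botP s.1 l j) 0 * - B i l = 0 :=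
            Finset.sum_eq_zero fun l _ => by
              have := hcε l
              rw [max_eq_right (by omega), zero_mul]
          rw [this, add_zero]
          refine Finset.sum_congr rfl fun l _ => ?_
          rw [mul_comm]; simp
      have hsum : ∀ (x y : Fin n → ℤ),
          (∑ l, (((x l).toNat : ℕ) : ℤ) • (fun i => G i l) +
            ∑ l, (((y l).toNat : ℕ) : ℤ) • (fun i => - B i l)) =
          fun i => ∑ l, max (x l) 0 * G i l + ∑ l, max (y l) 0 * - B i l := by
        intro x y
        funext i
        simp only [Pi.add_apply, Finset.sum_apply, Pi.smul_apply, smul_eq_mul, toNat_max]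
      rw [hsum (fun l => s.1 (Sum.inl l) j) (fun l => s.1 (Sum.inr l) j)] at P1
      rw [hsum (fun l => - s.1 (Sum.inl l) j) (fun l => - s.1 (Sum.inr l) j)] at P2
      have q2 : (fun i => ∑ l, max (- s.1 (Sum.inl l) j) 0 * G i l +
          ∑ l, max (- s.1 (Sum.inr l) j) 0 * - B i l) = g := by
        funext i; exact (key2 i).symm
      have q1 : (fun i => ∑ l, max (s.1 (Sum.inl l) j) 0 * G i l +
          ∑ l, max (s.1 (Sum.inr l) j) 0 * - B i l) = g := by
        funext i; exact ((key2 i).trans (key i).symm).symm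
      rw [q1] at P1
      rw [q2] at P2
      convert (P1.add P2).div (hG j) using 1
      funext i
      rw [mul_matE, if_pos rfl]
      simp only [a, g, Pi.sub_apply, mul_sub, Finset.sum_sub_distrib]
      simp; ring
    · have e0 : (mutSeedP k s).2 j = s.2 j := by
        simp [mutSeedP, Function.update_of_ne hj]
      rw [e0]
      convert hG j using 1
      funext i
      rw [mul_matE, if_neg hj, add_zero]
  · rw [hB, hC]
    calc G * matE k a * (matE k a * topP s.1 * matF k c)
        = G * (matE k a * matE k a) * topP s.1 * matF k c := by simp only [Matrix.mul_assoc]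
      _ = G * topP s.1 * matF k c := by rw [matE_sq k a ha, Matrix.mul_one]
      _ = B * (botP s.1 * matF k c) := by rw [h1, Matrix.mul_assoc]
  · rw [hC, Matrix.transpose_mul]
    calc (matE k a)ᵀ * Gᵀ * Matrix.diagonal d * (botP s.1 * matF k c)
        = (matE k a)ᵀ * (Gᵀ * Matrix.diagonal d * botP s.1) * matF k c := by
          simp only [Matrix.mul_assoc]
      _ = Matrix.diagonal d * (matF k c * matF k c) := by
          rw [h2, matE_D k a c d hac, Matrix.mul_assoc]
      _ = Matrix.diagonal d := by rw [matF_sq k c hck, Matrix.mul_one]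
  · change ∀ i j, d i * topP (mutMatExt k s.1) i j = - (d j * topP (mutMatExt k s.1) j i)
    rw [topP_mut]
    exact mutMat_skew k _ d hd h3

theorem seedInv_all {B : Matrix (Fin n) (Fin n) ℤ} {d : Fin n → ℤ} (hd : ∀ i, 0 < d i)
    (hskew : ∀ i j, d i * B i j = - (d j * B j i)) (hB : IsReal B)
    {s : Matrix (Fin n ⊕ Fin n) (Fin n) ℤ × (Fin n → PField n)} (hs : IsSeedP B s) :
    SeedInv B d s ∧ IsExtMat B s.1 := by
  induction hs with
  | refl => exact ⟨seedInv_init B d hskew, Relation.ReflTransGen.refl⟩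
  | tail _ h ih =>
    obtain ⟨k, rfl⟩ := h
    exact ⟨ih.1.mut hd (extMat_coh B hB _ ih.2) k, ih.2.tail ⟨k, rfl⟩⟩

end SeedSec

end

/-- For a cluster algebra with principal coefficients of type `C_n` (`n ≥ 2`)
with skew-symmetrizer `D`, at every seed the `G`-matrix and the `C`-matrix
satisfy `Gᵀ · D · C = D`. -/
theorem G_transpose_D_C_eq_D_type_C {n : ℕ} (hn : 2 ≤ n)
    (B : Matrix (Fin n) (Fin n) ℤ) (htype : MatrixOfTypeC B)
    (d : Fin n → ℤ) (hd : ∀ i, 0 < d i)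
    (hskew : (Matrix.diagonal d * B)ᵀ = -(Matrix.diagonal d * B))
    (s : Matrix (Fin n ⊕ Fin n) (Fin n) ℤ × (Fin n → PField n))
    (hs : IsSeedP B s) (G : Matrix (Fin n) (Fin n) ℤ)
    (hG : ∀ j, HasGVector B (fun i => G i j) (s.2 j)) :
    Gᵀ * Matrix.diagonal d *
        Matrix.of (fun i j => s.1 (Sum.inr i) j) = Matrix.diagonal d := by
  have hsk : ∀ i j, d i * B i j = - (d j * B j i) := by
    intro i j
    have := congrFun (congrFun hskew j) i
    rw [Matrix.transpose_apply, Matrix.neg_apply, Matrix.diagonal_mul, Matrix.diagonal_mul] at this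
    exact this
  obtain ⟨⟨G0, h0, -, h2, -⟩, -⟩ := seedInv_all hd hsk (isReal_typeC B htype d hd hsk) hs
  have hGG : G = G0 := by
    ext i j
    exact congrFun ((h0 j).uniq (hG j)) i
  rw [hGG]
  exact h2
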